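/- arXiv:2110.13906 — 7 statements merged into one kernel-verified Lean document; each statement's English description precedes it below -/
import Mathlib

section
/- For every n ≥ 1, there exists a bijection φ: F_n → R_n such that, writing F = φ(f) for f = ((a_1 b_1),…,(a_n b_n)) ∈ F_n: area(f) = maj(F), coarea(f) = comaj(F), h(i) = b_i − a_i for every i ∈ {1,…,n}, and in addition for every i ∈ {1,…,n−1} one has a_i = a_{i+1} if and only if vertex i is a child of vertex i+1 in F. -/
/-- A rooted forest on vertex set `V`, encoded by its parent function:
`parent v = some u` means `u` is the parent of `v` (edges are directed away from
the roots, so `(u,v)` is an edge), and `parent v = none` means `v` is a root.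
Acyclicity guarantees that every connected component is a tree with a
distinguished root. -/
structure RootedForest (V : Type) where
  parent : V → Option V
  acyclic : ∀ v : V, ¬ Relation.TransGen (fun a b : V => parent a = some b) v v

namespace RootedForest

variable {V : Type} [Fintype V] [LinearOrder V]

/-- `F.Desc u v` means `v` is a (strict) descendant of `u`. -/
def Desc (F : RootedForest V) (u v : V) : Prop :=
  Relation.TransGen (fun a b : V => F.parent a = some b) v u

/-- The hook of `u`: `u` together with all of its descendants. -/
def hook (F : RootedForest V) (u : V) : Set V := {v : V | v = u ∨ F.Desc u v}

/-- The hook length `h(u)`. -/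
noncomputable def h (F : RootedForest V) (u : V) : ℕ := (F.hook u).ncard

/-- The left hook length `h_L(u)`: sum of hook lengths of children smaller than `u`. -/
noncomputable def hL (F : RootedForest V) (u : V) : ℕ :=
  ∑ v ∈ Finset.univ.filter (fun v : V => F.parent v = some u ∧ v < u), F.h v

/-- The right hook length `h_R(u)`: sum of hook lengths of children larger than `u`. -/
noncomputable def hR (F : RootedForest V) (u : V) : ℕ :=
  ∑ v ∈ Finset.univ.filter (fun v : V => F.parent v = some u ∧ u < v), F.h v

/-- The major index of a rooted forest. -/
noncomputable def maj (F : RootedForest V) : ℕ := ∑ u : V, F.hL u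

/-- The comajor index of a rooted forest. -/
noncomputable def comaj (F : RootedForest V) : ℕ := ∑ u : V, F.hR u

/-- The number of inversions: pairs `(u,v)` with `v` a descendant of `u` and `v < u`. -/
noncomputable def inv (F : RootedForest V) : ℕ :=
  {p : V × V | F.Desc p.1 p.2 ∧ p.2 < p.1}.ncard

/-- The number of coinversions: pairs `(u,v)` with `v` a descendant of `u` and `v > u`. -/
noncomputable def coinv (F : RootedForest V) : ℕ :=
  {p : V × V | F.Desc p.1 p.2 ∧ p.1 < p.2}.ncard

/-- The number of connected components (= number of roots). -/
def comps (F : RootedForest V) : ℕ :=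
  (Finset.univ.filter (fun v : V => F.parent v = none)).card

end RootedForest

/-- A `k`-forest on vertex set `Fin n` (vertices `1,…,n`): a rooted forest together with a
colour in `{0,…,k-1}` on each edge.  The colour of the edge `(parent v, v)` is recorded
at the vertex `v`; roots carry the dummy colour `0`. -/
structure KForest (n k : ℕ) extends RootedForest (Fin n) where
  colour : Fin n → ℕ
  colour_lt : ∀ v, colour v < k
  colour_root : ∀ v, parent v = none → colour v = 0

namespace KForest

variable {n k : ℕ}

/-- The chromatic depth `chr_k(F) = ∑_{(u,v) ∈ E(F)} κ(u,v)·h(v)`. -/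
noncomputable def chr (F : KForest n k) : ℕ :=
  ∑ v ∈ Finset.univ.filter (fun v : Fin n => F.parent v ≠ none),
    F.colour v * F.toRootedForest.h v

/-- The chromatic codepth `cochr_k(F) = ∑_{(u,v) ∈ E(F)} (k-1-κ(u,v))·h(v)`. -/
noncomputable def cochr (F : KForest n k) : ℕ :=
  ∑ v ∈ Finset.univ.filter (fun v : Fin n => F.parent v ≠ none),
    (k - 1 - F.colour v) * F.toRootedForest.h v

/-- `maj_k = maj + chr_k`. -/
noncomputable def majk (F : KForest n k) : ℕ := F.toRootedForest.maj + F.chr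

/-- `comaj_k = comaj + cochr_k`. -/
noncomputable def comajk (F : KForest n k) : ℕ := F.toRootedForest.comaj + F.cochr

/-- `inv_k = inv + chr_k`. -/
noncomputable def invk (F : KForest n k) : ℕ := F.toRootedForest.inv + F.chr

/-- `coinv_k = coinv + cochr_k`. -/
noncomputable def coinvk (F : KForest n k) : ℕ := F.toRootedForest.coinv + F.cochr

end KForest

/-- A minimal factorization of the long cycle `(0 1 ⋯ n)` on `{0,1,…,n}` into `n`
transpositions `(aᵢ bᵢ)` with `aᵢ < bᵢ`, multiplied left to right (the leftmost factor
is applied first, which corresponds to the reversed product in Mathlib's convention). -/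
structure MinFact (n : ℕ) where
  a : Fin n → Fin (n+1)
  b : Fin n → Fin (n+1)
  ab_lt : ∀ i, a i < b i
  prod_eq : (List.ofFn (fun i => Equiv.swap (a i) (b i))).reverse.prod = finRotate (n+1)

namespace MinFact

variable {n : ℕ}

/-- `area(f) = C(n,2) - ∑ aᵢ`. -/
def area (f : MinFact n) : ℤ := (n.choose 2 : ℤ) - ∑ i : Fin n, ((f.a i : ℕ) : ℤ)

/-- `coarea(f) = ∑ (bᵢ - 1) - C(n,2)`. -/
def coarea (f : MinFact n) : ℤ :=
  (∑ i : Fin n, (((f.b i : ℕ) : ℤ) - 1)) - (n.choose 2 : ℤ)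

end MinFact

/-- A minimal `k`-factorization of the long cycle `(0 1 ⋯ kn)` on `{0,1,…,kn}` into `n`
cycles of length `k+1`: the `j`-th factor is the cycle `(a j 0, a j 1, …, a j k)`
(sending `a j 0 ↦ a j 1 ↦ ⋯ ↦ a j k ↦ a j 0`), presented with its least element first,
and the factors are multiplied left to right (leftmost applied first). -/
structure MinKFact (n k : ℕ) where
  a : Fin n → Fin (k+1) → Fin (k*n+1)
  inj : ∀ j, Function.Injective (a j)
  min_first : ∀ j i, a j 0 ≤ a j i
  prod_eq :
    (List.ofFn (fun j => (List.ofFn (a j)).formPerm)).reverse.prod = finRotate (k*n+1)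

namespace MinKFact

variable {n k : ℕ}

/-- `area_k(f) = C(kn,2) - n·C(k,2) - k·∑_j a_j^0`. -/
def areak (f : MinKFact n k) : ℤ :=
  ((k*n).choose 2 : ℤ) - n * (k.choose 2 : ℤ) - k * ∑ j : Fin n, ((f.a j 0 : ℕ) : ℤ)

/-- `coarea_k(f) = k·∑_j (a_j^k - 1) - C(kn,2) - n·C(k,2)`. -/
def coareak (f : MinKFact n k) : ℤ :=
  k * (∑ j : Fin n, (((f.a j (Fin.last k) : ℕ) : ℤ) - 1))
    - ((k*n).choose 2 : ℤ) - n * (k.choose 2 : ℤ)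

/-- `semiarea_k(f) = C(kn,2) - ∑_{i=0}^{k-1} ∑_j a_j^i`. -/
def semiareak (f : MinKFact n k) : ℤ :=
  ((k*n).choose 2 : ℤ) - ∑ i : Fin k, ∑ j : Fin n, ((f.a j i.castSucc : ℕ) : ℤ)

/-- `cosemiarea_k(f) = ∑_{i=1}^{k} ∑_j (a_j^i - 1) - C(kn,2)`. -/
def cosemiareak (f : MinKFact n k) : ℤ :=
  (∑ i : Fin k, ∑ j : Fin n, (((f.a j i.succ : ℕ) : ℤ) - 1)) - ((k*n).choose 2 : ℤ)

end MinKFact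

/-- `p` is a `k`-parking function: its nondecreasing rearrangement `b = p ∘ sort p`
satisfies `b i ≤ k * i` (with 0-indexed `i`, matching `bᵢ ≤ k(i-1)` for 1-indexed `i`). -/
def IsParkingFunction (k : ℕ) {n : ℕ} (p : Fin n → ℕ) : Prop :=
  ∀ i : Fin n, p (Tuple.sort p i) ≤ k * i

/-- The displacement `disp_k(p) = k·C(n,2) - ∑ᵢ aᵢ` of a `k`-parking function. -/
def dispk (k : ℕ) {n : ℕ} (p : Fin n → ℕ) : ℤ :=
  k * (n.choose 2 : ℤ) - ∑ i : Fin n, (p i : ℤ)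

namespace Stmt8

/-! ### Partial products -/

def pp {n : ℕ} {G : Type} [Group G] (s : Fin n → G) (t : ℕ) : G :=
  ((List.ofFn s).take t).reverse.prod

theorem pp_zero {n : ℕ} {G : Type} [Group G] (s : Fin n → G) : pp s 0 = 1 := by
  simp [pp]

theorem pp_succ {n : ℕ} {G : Type} [Group G] (s : Fin n → G) (i : Fin n) :
    pp s (i + 1) = s i * pp s i := by
  unfold pp
  rw [List.take_add_one]
  simp

theorem pp_last {n : ℕ} {G : Type} [Group G] (s : Fin n → G) :
    pp s n = (List.ofFn s).reverse.prod := by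
  unfold pp
  rw [List.take_of_length_le (by simp)]

/-- induction up to `n` -/
theorem ind_le {n : ℕ} {p : ℕ → Prop} (h0 : p 0) (hs : ∀ i : Fin n, p i → p (i + 1)) :
    ∀ t, t ≤ n → p t := by
  intro t
  induction t with
  | zero => intro _; exact h0
  | succ k ih => intro hk; exact hs ⟨k, hk⟩ (ih (by omega))

/-- partial products of a factorization -/
def P {n : ℕ} (f : MinFact n) (t : ℕ) : Equiv.Perm (Fin (n + 1)) :=
  pp (fun i => Equiv.swap (f.a i) (f.b i)) t

theorem P_zero {n : ℕ} (f : MinFact n) : P f 0 = 1 := pp_zero _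

theorem P_succ {n : ℕ} (f : MinFact n) (i : Fin n) :
    P f (i + 1) = Equiv.swap (f.a i) (f.b i) * P f i := pp_succ _ i

theorem P_last {n : ℕ} (f : MinFact n) : P f n = finRotate (n + 1) := by
  unfold P
  rw [pp_last]
  exact f.prod_eq

/-- token product -/
def Q {n : ℕ} (par : Fin n → Option (Fin n)) (t : ℕ) : Equiv.Perm (Option (Fin n)) :=
  (pp (fun i => Equiv.swap (some i) (par i)) t)⁻¹

theorem Q_zero {n : ℕ} (par : Fin n → Option (Fin n)) : Q par 0 = 1 := by
  simp [Q, pp_zero]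

theorem Q_succ {n : ℕ} (par : Fin n → Option (Fin n)) (i : Fin n) :
    Q par (i + 1) = Q par i * Equiv.swap (some i) (par i) := by
  simp [Q, pp_succ]

structure Rel {n : ℕ} (f : MinFact n) (par : Fin n → Option (Fin n))
    (g : Option (Fin n) ≃ Fin (n + 1)) : Prop where
  none : g none = Fin.last n
  a : ∀ i : Fin n, P f i (g (some i)) = f.a i
  b : ∀ i : Fin n, P f i (g (par i)) = f.b i

theorem Rel.conj {n : ℕ} {f : MinFact n} {par : Fin n → Option (Fin n)}
    {g : Option (Fin n) ≃ Fin (n + 1)} (h : Rel f par g) :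
    ∀ t, t ≤ n → ∀ x, P f t (g x) = g (Q par t x) := by
  apply ind_le
  · intro x; simp [P_zero, Q_zero]
  · intro i ih x
    rw [P_succ, Q_succ, ← h.a i, ← h.b i]
    simp only [Equiv.Perm.mul_apply]
    rw [← ih]
    rcases eq_or_ne x (some i) with rfl | h1
    · simp
    · rcases eq_or_ne x (par i) with rfl | h2
      · simp
      · rw [Equiv.swap_apply_of_ne_of_ne h1 h2, Equiv.swap_apply_of_ne_of_ne]
        · simpa using h1
        · simpa using h2

theorem rot_ind {n : ℕ} {p : Fin (n + 1) → Prop} (hl : p (Fin.last n))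
    (hs : ∀ x, p x → p (finRotate (n + 1) x)) : ∀ x, p x := by
  intro x
  induction x using Fin.induction with
  | zero => have := hs _ hl; rwa [finRotate_last] at this
  | succ k ih =>
    have := hs _ ih
    have e : finRotate (n + 1) k.castSucc = k.succ := by
      rw [finRotate_apply]; simp
    rwa [e] at this

/-- (3) -/
theorem Rel.inj_left {n : ℕ} {f f' : MinFact n} {par : Fin n → Option (Fin n)}
    {g g' : Option (Fin n) ≃ Fin (n + 1)} (h : Rel f par g) (h' : Rel f' par g') : f = f' := by
  have key : ∀ y : Fin (n + 1), g' (g.symm y) = y := by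
    apply rot_ind
    · rw [← h.none, Equiv.symm_apply_apply, h'.none, h.none]
    · intro y hy
      have c := h.conj n le_rfl (g.symm y)
      have c' := h'.conj n le_rfl (g.symm y)
      rw [P_last] at c c'
      rw [hy] at c'
      simp only [Equiv.apply_symm_apply] at c
      rw [c]; simp [← c', c]
  have hg : g = g' := by
    ext x : 1
    have := key (g x)
    simpa using this.symm
  subst hg
  have hP : ∀ t, t ≤ n → P f t = P f' t := by
    intro t ht
    ext y : 1
    have c := h.conj t ht (g.symm y)
    have c' := h'.conj t ht (g.symm y)
    simp only [Equiv.apply_symm_apply] at c c'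
    rw [c, c']
  have ha : f.a = f'.a := by
    funext i; rw [← h.a i, ← h'.a i, hP i i.2.le]
  have hb : f.b = f'.b := by
    funext i; rw [← h.b i, ← h'.b i, hP i i.2.le]
  cases f; cases f'; simp only at ha hb; subst ha hb; rfl

/-- (4) -/
theorem Rel.inj_right {n : ℕ} {f : MinFact n} {par par' : Fin n → Option (Fin n)}
    {g g' : Option (Fin n) ≃ Fin (n + 1)} (h : Rel f par g) (h' : Rel f par' g') :
    par = par' := by
  have hg : g = g' := by
    ext x : 1
    cases x with
    | none => rw [h.none, h'.none]
    | some i => 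
      apply (P f i).injective
      rw [h.a, h'.a]
  subst hg
  funext i
  apply g.injective
  apply (P f i).injective
  rw [h.b, h'.b]

theorem Rel.acyclic {n : ℕ} {f : MinFact n} {par : Fin n → Option (Fin n)}
    {g : Option (Fin n) ≃ Fin (n + 1)} (h : Rel f par g) (v : Fin n) :
    ¬ Relation.TransGen (fun a b : Fin n => par a = some b) v v := by
  intro hv
  let S : Option (Fin n) → Prop := fun x =>
    ∃ i, x = some i ∧ Relation.ReflTransGen (fun a b : Fin n => par a = some b) i v
  have hS : ∀ i, S (some i) ↔ S (par i) := by
    intro i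
    constructor
    · rintro ⟨j, hj, hr⟩
      obtain rfl : i = j := by simpa using hj
      have ht : Relation.TransGen (fun a b : Fin n => par a = some b) i v := by
        rcases Relation.reflTransGen_iff_eq_or_transGen.1 hr with e | e
        · rw [← e]; exact hv
        · exact e
      obtain ⟨k, hk, hk2⟩ := Relation.TransGen.head'_iff.1 ht
      exact ⟨k, hk, hk2⟩
    · rintro ⟨j, hj, hr⟩
      exact ⟨i, rfl, Relation.ReflTransGen.head hj hr⟩
  have hQ : ∀ t, t ≤ n → ∀ x, S (Q par t x) ↔ S x := by
    apply ind_le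
    · intro x; simp [Q_zero]
    · intro i ih x
      rw [Q_succ, Equiv.Perm.mul_apply, ih]
      rcases eq_or_ne x (some i) with rfl | h1
      · simp [hS]
      · rcases eq_or_ne x (par i) with rfl | h2
        · simp [hS]
        · rw [Equiv.swap_apply_of_ne_of_ne h1 h2]
  have key : ∀ y, ¬ S (g.symm y) := by
    apply rot_ind
    · rw [← h.none]
      rintro ⟨i, hi, _⟩
      simp at hi
    · intro y hy
      have c := h.conj n le_rfl (g.symm y)
      rw [P_last, Equiv.apply_symm_apply] at c
      rw [c, Equiv.symm_apply_apply, hQ n le_rfl]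
      exact hy
  apply key (g (some v))
  rw [Equiv.symm_apply_apply]
  exact ⟨v, rfl, .refl⟩

/-- (1) -/
theorem exists_rel {n : ℕ} (f : MinFact n) : ∃ par g, Rel f par g := by
  have hsurj : ∀ v : Fin n, ∃ i : Fin n, P f i v.castSucc = f.a i := by
    intro v
    by_contra hcon
    push Not at hcon
    have : ∀ t, t ≤ n → P f t v.castSucc ≤ v.castSucc := by
      apply ind_le
      · simp [P_zero]
      · intro i ih
        rw [P_succ, Equiv.Perm.mul_apply]
        rcases eq_or_ne (P f i v.castSucc) (f.b i) with e | e
        · rw [e] at ih ⊢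
          rw [Equiv.swap_apply_right]
          exact (f.ab_lt i).le.trans ih
        · rwa [Equiv.swap_apply_of_ne_of_ne (hcon i) e]
    have h := this n le_rfl
    rw [P_last, finRotate_apply] at h
    have e : v.castSucc + 1 = v.succ := by simp
    rw [e] at h
    exact absurd h (by simp [Fin.le_def])
  choose k hk using hsurj
  have kinj : Function.Injective k := by
    intro v w hvw
    have h1 := hk v
    have h2 := hk w
    rw [hvw, ← h2] at h1
    have := (P f (k w)).injective h1
    exact Fin.castSucc_injective _ this
  let K : Fin n ≃ Fin n := Equiv.ofBijective k (Finite.injective_iff_bijective.1 kinj)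
  let g : Option (Fin n) ≃ Fin (n + 1) := (Equiv.optionCongr K.symm).trans finSuccEquivLast.symm
  refine ⟨fun i : Fin n => g.symm ((P f i).symm (f.b i)), g, ?_, ?_, ?_⟩
  · change finSuccEquivLast.symm none = Fin.last n
    simp
  · intro i
    obtain ⟨v, rfl⟩ := K.surjective i
    have : g (some (K v)) = v.castSucc := by
      change finSuccEquivLast.symm (some (K.symm (K v))) = v.castSucc
      rw [Equiv.symm_apply_apply]
      simp
    rw [this]
    exact hk v
  · intro i; simp

/-! ### From forests to factorizations -/

open Classical in
theorem cover {n : ℕ} (w : Fin n → ℕ) (S : Finset (Fin n)) (y : ℕ) (hy : y < ∑ j ∈ S, w j) :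
    ∃ k ∈ S, ∑ j ∈ S.filter (fun j : Fin n => (k : ℕ) + 1 ≤ (j : ℕ)), w j ≤ y ∧
      y < ∑ j ∈ S.filter (fun j : Fin n => (k : ℕ) + 1 ≤ (j : ℕ)), w j + w k := by
  induction S using Finset.induction_on_min with
  | empty => simp at hy
  | insert m S hm ih =>
    have hmS : m ∉ S := fun h => lt_irrefl _ (hm m h)
    rw [Finset.sum_insert hmS] at hy
    by_cases hy2 : y < ∑ j ∈ S, w j
    · obtain ⟨k, hkS, hk⟩ := ih hy2
      refine ⟨k, Finset.mem_insert_of_mem hkS, ?_⟩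
      have hmk := hm k hkS
      rw [Finset.filter_insert, if_neg (by have : (m : ℕ) < k := hmk; omega)]
      exact hk
    · refine ⟨m, Finset.mem_insert_self _ _, ?_⟩
      rw [Finset.filter_insert, if_neg (by omega), Finset.filter_true_of_mem]
      · omega
      · intro j hj
        have : (m : ℕ) < j := hm j hj
        omega

section Forest

variable {n : ℕ} (F : RootedForest (Fin n))

/-- parent relation -/
def r (a b : Fin n) : Prop := F.parent a = some b

theorem r_unique : Relator.RightUnique (r F) := by
  intro a b c h1 h2
  unfold r at h1 h2
  rw [h1] at h2
  simpa using h2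

theorem mem_hook (u v : Fin n) : v ∈ F.hook u ↔ Relation.ReflTransGen (r F) v u := by
  rw [Relation.reflTransGen_iff_eq_or_transGen]
  unfold RootedForest.hook RootedForest.Desc r
  simp only [Set.mem_ofPred_eq, eq_comm]

theorem up_wf : WellFounded (fun b a : Fin n => r F a b) := by
  have : WellFounded (fun b a : Fin n => Relation.TransGen (r F) a b) := by
    have t : IsTrans (Fin n) (fun b a : Fin n => Relation.TransGen (r F) a b) :=
      ⟨fun a b c h1 h2 => h2.trans h1⟩
    have i : Std.Irrefl (fun b a : Fin n => Relation.TransGen (r F) a b) :=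
      ⟨fun a h => F.acyclic a h⟩
    exact Finite.wellFounded_of_trans_of_irrefl _
  exact Subrelation.wf (fun h => Relation.TransGen.single h) this

open Classical in
/-- hook as a finset -/
noncomputable def hk (u : Fin n) : Finset (Fin n) :=
  Finset.univ.filter (fun v => Relation.ReflTransGen (r F) v u)

theorem h_eq (u : Fin n) : F.h u = (hk F u).card := by
  unfold RootedForest.h
  rw [← Set.ncard_coe_finset]
  congr 1
  ext v
  simp [hk, mem_hook]

/-- children -/
def ch (x : Option (Fin n)) : Finset (Fin n) :=
  Finset.univ.filter (fun v => F.parent v = x)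

theorem disj (x : Option (Fin n)) :
    Set.PairwiseDisjoint (↑(ch F x) : Set (Fin n)) (hk F) := by
  have aux : ∀ v v', F.parent v = x → F.parent v' = x → v ≠ v' →
      Relation.ReflTransGen (r F) v v' → False := by
    intro v v' h1 h2 hne h
    obtain rfl | ⟨c, hc, hc2⟩ := Relation.ReflTransGen.cases_head h
    · exact hne rfl
    · unfold r at hc
      have e : F.parent v' = some c := by rw [h2, ← h1, hc]
      exact F.acyclic c (Relation.TransGen.tail' hc2 e)
  intro v hv v' hv' hne
  simp only [ch, Finset.coe_filter, Finset.mem_univ, true_and, Set.mem_ofPred_eq] at hv hv'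
  rw [Function.onFun, Finset.disjoint_left]
  intro j hj hj'
  simp only [hk, Finset.mem_filter, Finset.mem_univ, true_and] at hj hj'
  rcases Relation.ReflTransGen.total_of_right_unique (r_unique F) hj hj' with h | h
  · exact aux _ _ hv hv' hne h
  · exact aux _ _ hv' hv hne.symm h

theorem h_rec (u : Fin n) : F.h u = 1 + ∑ v ∈ ch F (some u), F.h v := by
  classical
  simp only [h_eq]
  rw [← Finset.card_biUnion (disj F (some u))]
  have : hk F u = insert u ((ch F (some u)).biUnion (hk F)) := by
    ext j
    simp only [hk, ch, Finset.mem_filter, Finset.mem_univ, true_and, Finset.mem_insert,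
      Finset.mem_biUnion]
    rw [Relation.ReflTransGen.cases_tail_iff]
    constructor
    · rintro (h | ⟨c, h1, h2⟩)
      · exact Or.inl h.symm
      · exact Or.inr ⟨c, h2, h1⟩
    · rintro (h | ⟨c, h1, h2⟩)
      · exact Or.inl h.symm
      · exact Or.inr ⟨c, h2, h1⟩
  rw [this, Finset.card_insert_of_notMem, add_comm]
  simp only [hk, ch, Finset.mem_filter, Finset.mem_univ, true_and, Finset.mem_biUnion]
  rintro ⟨v, hv, hr⟩
  exact F.acyclic u (Relation.TransGen.tail' hr hv)

theorem roots_sum : ∑ v ∈ ch F none, F.h v = n := by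
  classical
  simp only [h_eq]
  rw [← Finset.card_biUnion (disj F none)]
  have : (ch F none).biUnion (hk F) = Finset.univ := by
    ext j
    simp only [hk, ch, Finset.mem_filter, Finset.mem_univ, true_and, Finset.mem_biUnion,
      iff_true]
    induction j using (up_wf F).induction with
    | _ j ih =>
      rcases hj : F.parent j with _ | p
      · exact ⟨j, hj, .refl⟩
      · obtain ⟨v, hv, hr⟩ := ih p hj
        exact ⟨v, hv, Relation.ReflTransGen.head hj hr⟩
  rw [this]; simp

theorem h_pos (u : Fin n) : 0 < F.h u := by rw [h_rec]; omega

/-- left / right children -/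
def lc (p : Fin n) : Finset (Fin n) := (ch F (some p)).filter (fun v => v < p)
def rc (p : Fin n) : Finset (Fin n) := (ch F (some p)).filter (fun v => p < v)

theorem hL_eq (p : Fin n) : F.hL p = ∑ v ∈ lc F p, F.h v := by
  unfold RootedForest.hL lc ch
  rw [Finset.filter_filter]

theorem hR_eq (p : Fin n) : F.hR p = ∑ v ∈ rc F p, F.h v := by
  unfold RootedForest.hR rc ch
  rw [Finset.filter_filter]

theorem h_split (p : Fin n) : F.h p = F.hL p + 1 + F.hR p := by
  rw [h_rec, hL_eq, hR_eq, ← Finset.sum_filter_add_sum_filter_not _ (fun v => v < p)]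
  have : (ch F (some p)).filter (fun v => ¬ v < p) = rc F p := by
    unfold rc
    apply Finset.filter_congr
    intro v hv
    have : v ≠ p := by
      rintro rfl
      simp only [ch, Finset.mem_filter, Finset.mem_univ, true_and] at hv
      exact F.acyclic v (Relation.TransGen.single hv)
    constructor
    · intro h; exact lt_of_le_of_ne (not_lt.1 h) this.symm
    · intro h; exact not_lt.2 h.le
  rw [this]
  unfold lc
  omega

/-- partial sum from `t` -/
noncomputable def sm (S : Finset (Fin n)) (t : ℕ) : ℕ :=
  ∑ v ∈ S.filter (fun v : Fin n => t ≤ (v : ℕ)), F.h v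

theorem sm_step (S : Finset (Fin n)) (i : Fin n) :
    sm F S i = sm F S (i + 1) + if i ∈ S then F.h i else 0 := by
  unfold sm
  split_ifs with h
  · have : S.filter (fun v : Fin n => (i : ℕ) ≤ (v : ℕ)) =
        insert i (S.filter (fun v : Fin n => (i : ℕ) + 1 ≤ (v : ℕ))) := by
      ext v
      simp only [Finset.mem_filter, Finset.mem_insert, Fin.ext_iff]
      constructor
      · rintro ⟨h1, h2⟩
        by_cases e : (v : ℕ) = i
        · exact Or.inl e
        · exact Or.inr ⟨h1, by omega⟩
      · rintro (e | ⟨h1, h2⟩)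
        · obtain rfl := Fin.ext e
          exact ⟨h, le_rfl⟩
        · exact ⟨h1, by omega⟩
    rw [this, Finset.sum_insert (by simp)]
    omega
  · rw [add_zero]
    congr 1
    apply Finset.filter_congr
    intro v hv
    have : (v : ℕ) ≠ i := fun e => h (Fin.ext e ▸ hv)
    omega

theorem sm_zero (S : Finset (Fin n)) : sm F S 0 = ∑ v ∈ S, F.h v := by
  simp [sm]

theorem sm_le (S : Finset (Fin n)) (t : ℕ) : sm F S t ≤ ∑ v ∈ S, F.h v :=
  Finset.sum_le_sum_of_subset (Finset.filter_subset _ _)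

theorem sm_all (S : Finset (Fin n)) (t : ℕ) (h : ∀ v ∈ S, t ≤ (v : ℕ)) :
    sm F S t = ∑ v ∈ S, F.h v := by
  unfold sm; rw [Finset.filter_true_of_mem h]

theorem sm_none (S : Finset (Fin n)) (t : ℕ) (h : ∀ v ∈ S, (v : ℕ) < t) :
    sm F S t = 0 := by
  unfold sm; rw [Finset.filter_false_of_mem]
  · rfl
  · intro v hv; have := h v hv; omega

/-- relative position of token -/
noncomputable def D (x : Option (Fin n)) (t : ℕ) : ℕ :=
  match x with
  | none => sm F (ch F none) t
  | some p => if (p : ℕ) < t then F.hL p + 1 + sm F (rc F p) t else sm F (lc F p) t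

theorem D_self (i : Fin n) : D F (some i) i = 0 := by
  unfold D
  simp only [lt_irrefl, if_false]
  apply sm_none
  intro v hv
  simp only [lc, Finset.mem_filter] at hv
  exact hv.2

theorem D_self_succ (i : Fin n) : D F (some i) (i + 1) = F.h i := by
  unfold D
  simp only [Nat.lt_succ_self, if_true]
  rw [sm_all, h_split, hR_eq]
  intro v hv
  simp only [rc, Finset.mem_filter] at hv
  exact hv.2

theorem parent_ne (i : Fin n) : F.parent i ≠ some i := fun h =>
  F.acyclic i (Relation.TransGen.single h)

theorem D_step (x : Option (Fin n)) (i : Fin n) (hx : x ≠ some i) :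
    D F x i = D F x (i + 1) + if F.parent i = x then F.h i else 0 := by
  cases x with
  | none =>
    unfold D
    simp only
    rw [sm_step]
    simp [ch]
  | some p =>
    have hp : (p : ℕ) ≠ i := fun e => hx (by rw [Fin.ext e])
    unfold D
    simp only
    by_cases hpi : (p : ℕ) < i
    · rw [if_pos hpi, if_pos (by omega), sm_step]
      have : p < i := hpi
      simp [rc, ch, this, add_assoc]
    · rw [if_neg hpi, if_neg (by omega), sm_step]
      have : i < p := by rw [Fin.lt_def]; omega
      simp [lc, ch, this]

theorem D_some_zero (p : Fin n) : D F (some p) 0 = F.hL p := by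
  unfold D; simp [sm_zero, hL_eq]

theorem D_none_zero : D F none 0 = n := by
  unfold D; simp [sm_zero, roots_sum]

theorem D_some_last (p : Fin n) : D F (some p) n = F.hL p + 1 := by
  unfold D; simp only [p.2, if_true]; rw [sm_none _ _ _ (fun v _ => v.2)]

theorem D_none_last : D F none n = 0 := by
  unfold D; simp only; rw [sm_none _ _ _ (fun v _ => v.2)]

theorem D_some_le (p : Fin n) (t : ℕ) : D F (some p) t ≤ F.h p := by
  unfold D
  simp only
  rw [h_split]
  have h1 := sm_le F (lc F p) t
  have h2 := sm_le F (rc F p) t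
  rw [← hL_eq] at h1
  rw [← hR_eq] at h2
  split_ifs <;> omega

theorem D_none_le (t : ℕ) : D F none t ≤ n := by
  unfold D
  simp only
  exact (sm_le F _ t).trans (roots_sum F).le

open Classical in
noncomputable def av (i : Fin n) : ℕ :=
  ∑ x ∈ Finset.univ.filter (fun x => Relation.ReflTransGen (r F) i x), D F (F.parent x) (x + 1)

noncomputable def A (x : Option (Fin n)) : ℕ := x.elim 0 (av F)

noncomputable def pos (t : ℕ) (x : Option (Fin n)) : ℕ := A F x + D F x t

theorem av_eq (i : Fin n) : av F i = pos F (i + 1) (F.parent i) := by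
  classical
  unfold pos
  rcases hi : F.parent i with _ | p
  · unfold av
    have : (Finset.univ.filter (fun x => Relation.ReflTransGen (r F) i x)) = {i} := by
      ext x
      simp only [Finset.mem_filter, Finset.mem_univ, true_and, Finset.mem_singleton]
      rw [Relation.ReflTransGen.cases_head_iff]
      simp [r, hi, eq_comm]
    rw [this]
    simp [A, hi]
  · have : (Finset.univ.filter (fun x => Relation.ReflTransGen (r F) i x)) =
        insert i (Finset.univ.filter (fun x => Relation.ReflTransGen (r F) p x)) := by
      ext x
      simp only [Finset.mem_filter, Finset.mem_univ, true_and, Finset.mem_insert]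
      rw [Relation.ReflTransGen.cases_head_iff]
      simp [r, hi, eq_comm]
    have h2 : i ∉ (Finset.univ.filter (fun x => Relation.ReflTransGen (r F) p x)) := by
      simp only [Finset.mem_filter, Finset.mem_univ, true_and]
      intro h
      exact F.acyclic i (Relation.TransGen.head' hi h)
    conv_lhs => unfold av
    rw [this, Finset.sum_insert h2, hi, add_comm]
    rfl

theorem pos_parent (i : Fin n) : pos F i (F.parent i) = av F i + F.h i := by
  rw [av_eq]
  unfold pos
  rw [D_step F _ i (parent_ne F i)]
  simp [add_assoc]

theorem pos_self (i : Fin n) : pos F i (some i) = av F i := by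
  unfold pos; rw [D_self]; rfl

theorem pos_self_succ (i : Fin n) : pos F (i + 1) (some i) = av F i + F.h i := by
  unfold pos; rw [D_self_succ]; rfl

theorem pos_other (i : Fin n) (x : Option (Fin n)) (h1 : x ≠ some i) (h2 : x ≠ F.parent i) :
    pos F (i + 1) x = pos F i x := by
  unfold pos; rw [D_step F x i h1, if_neg h2.symm, add_zero]

theorem bv_le (i : Fin n) : av F i + F.h i ≤ n := by
  induction i using (up_wf F).induction with
  | _ i ih =>
    rw [← pos_parent]
    unfold pos
    rcases hi : F.parent i with _ | p
    · simpa [A] using D_none_le F i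
    · have h1 := ih p hi
      have h2 := D_some_le F p i
      have h3 : A F (some p) = av F p := rfl
      omega

theorem surj_aux (m : ℕ) : ∀ u : Fin n, F.h u ≤ m → ∀ v, av F u ≤ v → v < av F u + F.h u →
    ∃ j, pos F 0 (some j) = v := by
  induction m with
  | zero => intro u hu; have := h_pos F u; omega
  | succ m ih =>
    intro u hu v hv1 hv2
    have hs := h_split F u
    have hrec := h_rec F u
    have key : ∀ k, F.parent k = some u → pos F (k + 1) (some u) ≤ v →
        v < pos F (k + 1) (some u) + F.h k → ∃ j, pos F 0 (some j) = v := by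
      intro k hk h1 h2
      have hk' := av_eq F k
      rw [hk] at hk'
      have : F.h k ≤ ∑ v ∈ ch F (some u), F.h v :=
        Finset.single_le_sum (f := F.h) (fun _ _ => Nat.zero_le _) (by simp [ch, hk])
      exact ih k (by omega) v (by omega) (by omega)
    have hA : A F (some u) = av F u := rfl
    rcases lt_trichotomy (v - av F u) (F.hL u) with h | h | h
    · rw [hL_eq] at h
      obtain ⟨k, hkS, h1, h2⟩ := cover F.h _ _ h
      simp only [lc, ch, Finset.mem_filter, Finset.mem_univ, true_and] at hkS
      have hku : (k : ℕ) < u := hkS.2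
      have hD : pos F (k + 1) (some u) = av F u + sm F (lc F u) (k + 1) := by
        unfold pos D
        simp only
        rw [if_neg (by omega), hA]
      apply key k hkS.1
      · rw [hD]; unfold sm; omega
      · rw [hD]; unfold sm; omega
    · refine ⟨u, ?_⟩
      unfold pos
      rw [D_some_zero, hA]
      omega
    · have h' : v - av F u - F.hL u - 1 < F.hR u := by omega
      rw [hR_eq] at h'
      obtain ⟨k, hkS, h1, h2⟩ := cover F.h _ _ h'
      simp only [rc, ch, Finset.mem_filter, Finset.mem_univ, true_and] at hkS
      have hku : (u : ℕ) < k := hkS.2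
      have hD : pos F (k + 1) (some u) = av F u + (F.hL u + 1 + sm F (rc F u) (k + 1)) := by
        unfold pos D
        simp only
        rw [if_pos (by omega), hA]
      apply key k hkS.1
      · rw [hD]; unfold sm; omega
      · rw [hD]; unfold sm; omega

theorem surj (v : Fin (n + 1)) : ∃ x, pos F 0 x = v := by
  by_cases hv : (v : ℕ) = n
  · refine ⟨none, ?_⟩
    unfold pos
    rw [D_none_zero, hv]; simp [A]
  · have : (v : ℕ) < n := by omega
    replace this := this.trans_eq (roots_sum F).symm
    obtain ⟨k, hkS, h1, h2⟩ := cover F.h _ _ this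
    simp only [ch, Finset.mem_filter, Finset.mem_univ, true_and] at hkS
    have ha : av F k = sm F (ch F none) (k + 1) := by
      rw [av_eq, hkS]
      simp [pos, A, D]
    obtain ⟨j, hj⟩ := surj_aux F _ k le_rfl v (by rw [ha]; exact h1) (by rw [ha]; exact h2)
    exact ⟨some j, hj⟩

theorem exists_g : ∃ g : Option (Fin n) ≃ Fin (n + 1), ∀ x, (g x : ℕ) = pos F 0 x := by
  choose s hs using surj F
  have hinj : Function.Injective s := by
    intro v w h
    apply Fin.ext
    rw [← hs v, ← hs w, h]
  have hbij : Function.Bijective s :=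
    (Fintype.bijective_iff_injective_and_card s).2 ⟨hinj, by simp⟩
  refine ⟨(Equiv.ofBijective s hbij).symm, fun x => ?_⟩
  obtain ⟨v, rfl⟩ := hbij.2 x
  rw [hs]
  congr 1
  exact Equiv.ofBijective_symm_apply_apply s hbij v

noncomputable def fa (i : Fin n) : Fin (n + 1) :=
  ⟨av F i, by have := bv_le F i; omega⟩
noncomputable def fb (i : Fin n) : Fin (n + 1) :=
  ⟨av F i + F.h i, by have := bv_le F i; omega⟩

theorem track (g : Option (Fin n) ≃ Fin (n + 1)) (hg : ∀ x, (g x : ℕ) = pos F 0 x) :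
    ∀ t, t ≤ n → ∀ x,
      (pp (fun i => Equiv.swap (fa F i) (fb F i)) t (g x) : ℕ) = pos F t x := by
  apply ind_le
  · intro x; simp [pp_zero, hg]
  · intro i ih x
    rw [pp_succ, Equiv.Perm.mul_apply]
    have ea : pp (fun i => Equiv.swap (fa F i) (fb F i)) i (g (some i)) = fa F i := by
      apply Fin.ext; rw [ih, pos_self]; rfl
    have eb : pp (fun i => Equiv.swap (fa F i) (fb F i)) i (g (F.parent i)) = fb F i := by
      apply Fin.ext; rw [ih, pos_parent]; rfl
    rcases eq_or_ne x (some i) with rfl | h1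
    · rw [ea, Equiv.swap_apply_left, pos_self_succ]; rfl
    · rcases eq_or_ne x (F.parent i) with rfl | h2
      · rw [eb, Equiv.swap_apply_right, ← av_eq]; rfl
      · rw [Equiv.swap_apply_of_ne_of_ne, ih, pos_other F i x h1 h2]
        · rw [← ea]; simpa using h1
        · rw [← eb]; simpa using h2

/-- the factorization of a forest -/
noncomputable def fact : MinFact n where
  a := fa F
  b := fb F
  ab_lt i := by
    have := h_pos F i
    simp only [fa, fb, Fin.lt_def]; omega
  prod_eq := by
    obtain ⟨g, hg⟩ := exists_g F
    rw [← pp_last]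
    ext y : 1
    obtain ⟨x, rfl⟩ := g.surjective y
    apply Fin.ext
    rw [track F g hg n le_rfl]
    cases x with
    | none =>
      have : g none = Fin.last n := by
        apply Fin.ext
        rw [hg]; simp [pos, D_none_zero, A]
      rw [this, finRotate_last]
      simp [pos, D_none_last, A]
    | some i =>
      have h1 := hg (some i)
      have h2 := bv_le F i
      have h3 := h_split F i
      have hA : A F (some i) = av F i := rfl
      unfold pos at h1 ⊢
      rw [D_some_zero] at h1
      rw [D_some_last]
      rw [coe_finRotate_of_ne_last]
      · omega
      · intro e
        rw [e] at h1
        simp only [Fin.val_last] at h1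
        omega

theorem fact_rel (g : Option (Fin n) ≃ Fin (n + 1)) (hg : ∀ x, (g x : ℕ) = pos F 0 x) :
    Rel (fact F) F.parent g := by
  refine ⟨?_, ?_, ?_⟩
  · apply Fin.ext
    rw [hg]; simp [pos, D_none_zero, A]
  · intro i
    apply Fin.ext
    refine (track F g hg i i.2.le _).trans ?_
    rw [pos_self]; rfl
  · intro i
    apply Fin.ext
    refine (track F g hg i i.2.le _).trans ?_
    rw [pos_parent]; rfl

theorem sum_c : ∑ i : Fin n, (av F i + F.hL i) = n.choose 2 := by
  obtain ⟨g, hg⟩ := exists_g F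
  have h1 : ∑ x, (g x : ℕ) = ∑ v : Fin (n + 1), (v : ℕ) := Equiv.sum_comp g (fun v => (v : ℕ))
  rw [Fin.sum_univ_castSucc, Fintype.sum_option] at h1
  simp only [hg] at h1
  have h2 : pos F 0 none = n := by simp [pos, D_none_zero, A]
  have h3 : ∀ i, pos F 0 (some i) = av F i + F.hL i := by
    intro i; unfold pos; rw [D_some_zero]; rfl
  simp only [h2, h3, Fin.val_castSucc, Fin.val_last] at h1
  rw [Fin.sum_univ_eq_sum_range (fun i => i) n, Finset.sum_range_id, ← Nat.choose_two_right] at h1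
  omega

theorem fact_props :
    MinFact.area (fact F) = (F.maj : ℤ) ∧
    MinFact.coarea (fact F) = (F.comaj : ℤ) ∧
    (∀ i : Fin n, (F.h i : ℤ) = (((fact F).b i : ℕ) : ℤ) - (((fact F).a i : ℕ) : ℤ)) ∧
    ∀ (i : Fin n) (hi : (i : ℕ) + 1 < n),
      (fact F).a i = (fact F).a ⟨(i : ℕ) + 1, hi⟩ ↔ F.parent i = some ⟨(i : ℕ) + 1, hi⟩ := by
  have hs := sum_c F
  rw [Finset.sum_add_distrib] at hs
  have hs' : (∑ i, (av F i : ℤ)) + ∑ i, (F.hL i : ℤ) = (n.choose 2 : ℤ) := by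
    exact_mod_cast hs
  refine ⟨?_, ?_, ?_, ?_⟩
  · unfold MinFact.area RootedForest.maj fact fa
    push_cast
    linarith
  · unfold MinFact.coarea RootedForest.comaj fact fb
    push_cast
    have : ∀ i, ((av F i : ℤ) + (F.h i : ℤ)) - 1 = (av F i : ℤ) + F.hL i + F.hR i := by
      intro i; rw [h_split F i]; push_cast; ring
    simp only [this, Finset.sum_add_distrib]
    linarith
  · intro i
    simp [fact, fa, fb]
  · intro i hi
    obtain ⟨g, hg⟩ := exists_g F
    have t := track F g hg (i + 1) hi.le
    have e1 := t (F.parent i)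
    have e2 := t (some ⟨i + 1, hi⟩)
    rw [← av_eq] at e1
    have e3 := pos_self F ⟨i + 1, hi⟩
    simp only at e3
    rw [e3] at e2
    simp only [fact, fa, Fin.mk.injEq]
    rw [← e1, ← e2]
    rw [Fin.val_inj, Equiv.apply_eq_iff_eq, Equiv.apply_eq_iff_eq]

end Forest

end Stmt8

/-- For every `n ≥ 1` there is a bijection `φ : F_n → R_n` such that,
with `F = φ f`: `area f = maj F`, `coarea f = comaj F`, `h(i) = b_i - a_i` for every
vertex `i`, and for every `i ∈ {1,…,n-1}` one has `a_i = a_{i+1}` iff vertex `i` is a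
child of vertex `i+1` in `F`. -/
theorem stmt8 (n : ℕ) (hn : 1 ≤ n) :
    ∃ φ : MinFact n ≃ RootedForest (Fin n),
      ∀ f : MinFact n,
        MinFact.area f = ((φ f).maj : ℤ) ∧
        MinFact.coarea f = ((φ f).comaj : ℤ) ∧
        (∀ i : Fin n, ((φ f).h i : ℤ) = ((f.b i : ℕ) : ℤ) - ((f.a i : ℕ) : ℤ)) ∧
        ∀ (i : Fin n) (hi : (i : ℕ) + 1 < n),
          f.a i = f.a ⟨(i : ℕ) + 1, hi⟩ ↔ (φ f).parent i = some ⟨(i : ℕ) + 1, hi⟩ := by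
  classical
  choose par g hg using fun f : MinFact n => Stmt8.exists_rel f
  have hfact : ∀ F : RootedForest (Fin n), ∃ g', Stmt8.Rel (Stmt8.fact F) F.parent g' := by
    intro F
    obtain ⟨g', hg'⟩ := Stmt8.exists_g F
    exact ⟨g', Stmt8.fact_rel F g' hg'⟩
  have hfp : ∀ F, par (Stmt8.fact F) = F.parent := by
    intro F
    obtain ⟨g', hg'⟩ := hfact F
    exact (hg _).inj_right hg'
  let φ : MinFact n ≃ RootedForest (Fin n) :=
    { toFun := fun f => ⟨par f, (hg f).acyclic⟩
      invFun := Stmt8.fact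
      left_inv := by
        intro f
        obtain ⟨g', hg'⟩ := hfact ⟨par f, (hg f).acyclic⟩
        exact hg'.inj_left (hg f)
      right_inv := by
        intro F
        have := hfp F
        cases F
        simp only [RootedForest.mk.injEq]
        exact this }
  refine ⟨φ, fun f => ?_⟩
  have h := Stmt8.fact_props (φ f)
  have e : Stmt8.fact (φ f) = f := φ.symm_apply_apply f
  rw [e] at h
  exact h
end

section
/- Let n, k ≥ 1, let S = {1_1 < 1_2 < … < 1_k < 2_1 < … < 2_k < … < n_1 < … < n_k} be a linearly ordered set of kn labels, and let R*_{kn} be the set of rooted forests on vertex set S such that for all j ∈ {1,…,n} and i ∈ {1,…,k−1}, vertex j_i is a child of vertex j_{i+1}. Define join: R*_{kn} → R_n^k by assigning colour k−i to each edge (j_i, r_s) with r ≠ j and then merging the vertices j_1,…,j_k into a single vertex labelled j, for each j. Then join is a bijection, and for every F* ∈ R*_{kn} with F = join(F*): maj(F*) = n·C(k,2) + k·maj_k(F) and comaj(F*) = k·comaj(F). -/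
instance (n k : ℕ) : Fintype (Fin n ×ₗ Fin k) := inferInstanceAs (Fintype (Fin n × Fin k))

/-- The set `R*_{kn}`: rooted forests on the lexicographically ordered label set
`S = {1_1 < ⋯ < 1_k < 2_1 < ⋯ < n_k}` (label `j_{i+1}` is `toLex (j, i)`, 0-indexed)
in which `j_i` is a child of `j_{i+1}` for all `j` and all `1 ≤ i ≤ k-1`. -/
def ChainUp (n k : ℕ) (Fs : RootedForest (Fin n ×ₗ Fin k)) : Prop :=
  ∀ (j : Fin n) (i : Fin k) (hi : (i : ℕ) + 1 < k),
    Fs.parent (toLex (j, i)) = some (toLex (j, ⟨(i : ℕ) + 1, hi⟩))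

namespace JoinAux

open Relation

section General

variable {V : Type} [Fintype V] [LinearOrder V]

theorem ext_parent {V : Type} {F G : RootedForest V} (h : F.parent = G.parent) : F = G := by
  cases F; cases G; cases h; rfl

theorem desc_iff (F : RootedForest V) (u w : V) :
    F.Desc u w ↔ ∃ c, F.parent c = some u ∧ w ∈ F.hook c := by
  unfold RootedForest.hook RootedForest.Desc
  rw [TransGen.tail'_iff]
  constructor
  · rintro ⟨c, h1, h2⟩
    refine ⟨c, h2, ?_⟩
    rcases reflTransGen_iff_eq_or_transGen.1 h1 with h | h
    · exact Or.inl h.symm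
    · exact Or.inr h
  · rintro ⟨c, h2, h1⟩
    refine ⟨c, ?_, h2⟩
    rcases h1 with h | h
    · rw [h]
    · exact h.to_reflTransGen

theorem mem_hook (F : RootedForest V) (u w : V) :
    w ∈ F.hook u ↔ ReflTransGen (fun a b : V => F.parent a = some b) w u := by
  unfold RootedForest.hook RootedForest.Desc
  rw [reflTransGen_iff_eq_or_transGen]
  simp only [Set.mem_ofPred_eq]
  exact or_congr_left eq_comm

theorem comparable (F : RootedForest V) (u c d w : V) (hc : F.parent c = some u)
    (hd : F.parent d = some u) (h1 : w ∈ F.hook c) (h2 : w ∈ F.hook d) : c = d := by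
  rw [mem_hook] at h1 h2
  have key : ∀ c d : V, F.parent c = some u → F.parent d = some u →
      ReflTransGen (fun a b : V => F.parent a = some b) c d → c = d := by
    intro c d hc hd h
    rcases ReflTransGen.cases_head h with h | ⟨x, hx, hxd⟩
    · exact h
    · exfalso
      have hx' : F.parent c = some x := hx
      rw [hc] at hx'
      cases hx'
      exact F.acyclic d (TransGen.head' hd hxd)
  have tot : ReflTransGen (fun a b : V => F.parent a = some b) c d ∨
      ReflTransGen (fun a b : V => F.parent a = some b) d c := by
    refine ReflTransGen.total_of_right_unique ?_ h1 h2
    intro a b c h1 h2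
    have h1' : F.parent a = some b := h1
    have h2' : F.parent a = some c := h2
    rw [h1'] at h2'
    exact Option.some.inj h2'
  rcases tot with h | h
  · exact key c d hc hd h
  · exact (key d c hd hc h).symm

theorem h_rec (F : RootedForest V) (u : V) :
    F.h u = 1 + ∑ c : V, if F.parent c = some u then F.h c else 0 := by
  classical
  rw [← Finset.sum_filter]
  have e : F.hook u = ((insert u ((Finset.univ.filter (fun c => F.parent c = some u)).biUnion
      (fun c => Finset.univ.filter (fun w => w ∈ F.hook c))) : Finset V) : Set V) := by
    ext w
    simp only [Finset.coe_insert, Set.mem_insert_iff, Finset.mem_coe, Finset.mem_biUnion,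
      Finset.mem_filter, Finset.mem_univ, true_and]
    rw [← desc_iff]
    rfl
  unfold RootedForest.h
  rw [e, Set.ncard_coe_finset, Finset.card_insert_of_notMem, Finset.card_biUnion, add_comm]
  · congr 1
    refine Finset.sum_congr rfl fun c _ => ?_
    rw [← Set.ncard_coe_finset]
    congr 1
    ext w; simp
  · intro c hc d hd hcd
    rw [Function.onFun, Finset.disjoint_left]
    intro w hw hw'
    simp only [Finset.coe_filter, Finset.mem_filter, Finset.mem_univ, true_and,
      Set.mem_ofPred_eq] at hc hd hw hw'
    exact hcd (comparable F u c d w hc hd hw hw')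
  · simp only [Finset.mem_biUnion, Finset.mem_filter, Finset.mem_univ, true_and]
    rw [← desc_iff]
    exact F.acyclic u

theorem maj_eq (F : RootedForest V) :
    F.maj = ∑ v : V, if (∃ u, F.parent v = some u ∧ v < u) then F.h v else 0 := by
  classical
  unfold RootedForest.maj RootedForest.hL
  simp only [Finset.sum_filter]
  rw [Finset.sum_comm]
  refine Finset.sum_congr rfl fun v _ => ?_
  cases hp : F.parent v with
  | none => simp
  | some p =>
    rw [Finset.sum_eq_single p]
    · simp
    · intro b _ hb
      rw [if_neg]
      rintro ⟨h, _⟩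
      exact hb (Option.some.inj h).symm
    · simp

theorem comaj_eq (F : RootedForest V) :
    F.comaj = ∑ v : V, if (∃ u, F.parent v = some u ∧ u < v) then F.h v else 0 := by
  classical
  unfold RootedForest.comaj RootedForest.hR
  simp only [Finset.sum_filter]
  rw [Finset.sum_comm]
  refine Finset.sum_congr rfl fun v _ => ?_
  cases hp : F.parent v with
  | none => simp
  | some p =>
    rw [Finset.sum_eq_single p]
    · simp
    · intro b _ hb
      rw [if_neg]
      rintro ⟨h, _⟩
      exact hb (Option.some.inj h).symm
    · simp

end General

section Join

variable {n m : ℕ}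

theorem sum_choose (m : ℕ) : ∑ i ∈ Finset.range m, (i + 1) = (m+1).choose 2 := by
  induction m with
  | zero => rfl
  | succ m ih => rw [Finset.sum_range_succ, ih, Nat.choose_succ_succ' (m+1) 1]; simp; ring

theorem sum_lex (f : Fin n ×ₗ Fin (m+1) → ℕ) :
    ∑ v, f v = ∑ j : Fin n, (∑ i : Fin m, f (toLex (j, i.castSucc))
      + f (toLex (j, Fin.last m))) := by
  have : ∑ v, f v = ∑ p : Fin n × Fin (m+1), f (toLex p) := rfl
  rw [this, Fintype.sum_prod_type]
  refine Finset.sum_congr rfl fun j _ => ?_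
  rw [Fin.sum_univ_castSucc]

theorem chain (Fs : RootedForest (Fin n ×ₗ Fin (m+1))) (H : ChainUp n (m+1) Fs)
    (j : Fin n) (i : Fin m) :
    Fs.parent (toLex (j, i.castSucc)) = some (toLex (j, i.succ)) :=
  H j i.castSucc (by simp)

theorem to_top (Fs : RootedForest (Fin n ×ₗ Fin (m+1))) (H : ChainUp n (m+1) Fs)
    (j : Fin n) (i : Fin (m+1)) :
    ReflTransGen (fun a b => Fs.parent a = some b) (toLex (j, i)) (toLex (j, Fin.last m)) := by
  induction i using Fin.reverseInduction with
  | last => exact ReflTransGen.refl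
  | cast i ih => exact ReflTransGen.head (chain Fs H j i) ih

/-- parent function of the joined forest -/
def jpar (Fs : RootedForest (Fin n ×ₗ Fin (m+1))) (r : Fin n) : Option (Fin n) :=
  (Fs.parent (toLex (r, Fin.last m))).map (fun p => (ofLex p).1)

theorem jpar_iff (Fs : RootedForest (Fin n ×ₗ Fin (m+1))) (r j : Fin n) :
    jpar Fs r = some j ↔ ∃ i, Fs.parent (toLex (r, Fin.last m)) = some (toLex (j, i)) := by
  unfold jpar
  rw [Option.map_eq_some_iff]
  constructor
  · rintro ⟨p, hp, rfl⟩
    exact ⟨(ofLex p).2, hp⟩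
  · rintro ⟨i, hi⟩
    exact ⟨_, hi, rfl⟩

theorem lift_path (Fs : RootedForest (Fin n ×ₗ Fin (m+1))) (H : ChainUp n (m+1) Fs)
    {u v : Fin n} (h : TransGen (fun a b => jpar Fs a = some b) u v) :
    TransGen (fun a b => Fs.parent a = some b) (toLex (u, Fin.last m))
      (toLex (v, Fin.last m)) := by
  have step : ∀ u v, jpar Fs u = some v →
      TransGen (fun a b => Fs.parent a = some b) (toLex (u, Fin.last m))
      (toLex (v, Fin.last m)) := by
    intro u v h
    obtain ⟨i, hi⟩ := (jpar_iff Fs u v).1 h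
    exact TransGen.head' hi (to_top Fs H v i)
  induction h with
  | single h => exact step _ _ h
  | tail _ h ih => exact ih.trans (step _ _ h)

theorem parent_cases (Fs : RootedForest (Fin n ×ₗ Fin (m+1))) (H : ChainUp n (m+1) Fs)
    (a b : Fin n ×ₗ Fin (m+1)) (h : Fs.parent a = some b) :
    (ofLex a).1 = (ofLex b).1 ∨ jpar Fs (ofLex a).1 = some (ofLex b).1 := by
  obtain ⟨⟨j, i⟩, rfl⟩ := toLex.surjective a
  obtain ⟨⟨j', i'⟩, rfl⟩ := toLex.surjective b
  induction i using Fin.lastCases with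
  | last =>
    right
    exact (jpar_iff Fs j j').2 ⟨i', h⟩
  | cast i =>
    left
    have h1 := (chain Fs H j i).symm.trans h
    have h2 := congrArg ofLex (Option.some.inj h1)
    have h3 : j = j' := congrArg Prod.fst h2
    exact h3

theorem proj_path (Fs : RootedForest (Fin n ×ₗ Fin (m+1))) (H : ChainUp n (m+1) Fs)
    {a b : Fin n ×ₗ Fin (m+1)} (h : ReflTransGen (fun a b => Fs.parent a = some b) a b) :
    ReflTransGen (fun a b => jpar Fs a = some b) (ofLex a).1 (ofLex b).1 := by
  induction h with
  | refl => exact ReflTransGen.refl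
  | tail _ h ih =>
    rcases parent_cases Fs H _ _ h with h | h
    · rw [← h]; exact ih
    · exact ih.tail h

/-- the joined k-forest -/
def joinF (Fs : RootedForest (Fin n ×ₗ Fin (m+1))) (H : ChainUp n (m+1) Fs) :
    KForest n (m+1) where
  parent := jpar Fs
  acyclic v h := Fs.acyclic _ (lift_path Fs H h)
  colour r := ((Fs.parent (toLex (r, Fin.last m))).map (fun p => m - ((ofLex p).2 : ℕ))).getD 0
  colour_lt r := by
    cases Fs.parent (toLex (r, Fin.last m)) with
    | none => simp
    | some p => simp only [Option.map_some, Option.getD_some]; omega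
  colour_root r h := by
    unfold jpar at h
    rw [Option.map_eq_none_iff] at h
    rw [h]; rfl

/-- parent function of the split forest -/
def spar (F : KForest n (m+1)) (p : Fin n ×ₗ Fin (m+1)) : Option (Fin n ×ₗ Fin (m+1)) :=
  Fin.lastCases (motive := fun _ => Option (Fin n ×ₗ Fin (m+1)))
    ((F.parent (ofLex p).1).map (fun q => toLex (q, ⟨m - F.colour (ofLex p).1, by omega⟩)))
    (fun i => some (toLex ((ofLex p).1, i.succ))) (ofLex p).2

theorem spar_last (F : KForest n (m+1)) (j : Fin n) :
    spar F (toLex (j, Fin.last m)) =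
      (F.parent j).map (fun q => toLex (q, ⟨m - F.colour j, by omega⟩)) := by
  simp [spar]

theorem spar_cast (F : KForest n (m+1)) (j : Fin n) (i : Fin m) :
    spar F (toLex (j, i.castSucc)) = some (toLex (j, i.succ)) := by
  simp [spar]

theorem spar_step (F : KForest n (m+1)) (a b : Fin n ×ₗ Fin (m+1)) (h : spar F a = some b) :
    ((ofLex a).1 = (ofLex b).1 ∧ (ofLex a).2 < (ofLex b).2) ∨
      F.parent (ofLex a).1 = some (ofLex b).1 := by
  obtain ⟨⟨j, i⟩, rfl⟩ := toLex.surjective a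
  obtain ⟨⟨j', i'⟩, rfl⟩ := toLex.surjective b
  induction i using Fin.lastCases with
  | last =>
    right
    have h1 := (spar_last F j).symm.trans h
    rw [Option.map_eq_some_iff] at h1
    obtain ⟨q, hq, hq'⟩ := h1
    have := congrArg Prod.fst (congrArg ofLex hq')
    change q = j' at this
    subst this
    exact hq
  | cast i =>
    left
    have h1 := (spar_cast F j i).symm.trans h
    have h2 := congrArg ofLex (Option.some.inj h1)
    have h3 : j = j' := congrArg Prod.fst h2
    have h4 : i.succ = i' := congrArg Prod.snd h2
    subst h3 h4
    exact ⟨rfl, Fin.castSucc_lt_succ⟩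

theorem spar_path (F : KForest n (m+1)) (a b : Fin n ×ₗ Fin (m+1))
    (h : TransGen (fun a b => spar F a = some b) a b) :
    ((ofLex a).1 = (ofLex b).1 ∧ (ofLex a).2 < (ofLex b).2) ∨
      TransGen (fun a b => F.parent a = some b) (ofLex a).1 (ofLex b).1 := by
  induction h with
  | single h => exact (spar_step F _ _ h).imp_right TransGen.single
  | tail _ h ih =>
    rcases ih with ⟨e, l⟩ | ih <;> rcases spar_step F _ _ h with ⟨e', l'⟩ | h'
    · exact Or.inl ⟨e.trans e', l.trans l'⟩
    · right; rw [e]; exact TransGen.single h'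
    · right; rw [← e']; exact ih
    · right; exact ih.tail h'

/-- the split forest -/
def splitF (F : KForest n (m+1)) : RootedForest (Fin n ×ₗ Fin (m+1)) where
  parent := spar F
  acyclic v h := by
    rcases spar_path F v v h with ⟨_, h⟩ | h
    · exact lt_irrefl _ h
    · exact F.acyclic _ h

theorem splitF_chain (F : KForest n (m+1)) : ChainUp n (m+1) (splitF F) := by
  intro j i hi
  have := spar_cast F j ⟨i, by omega⟩
  exact this

theorem kext {F G : KForest n (m+1)} (h : F.parent = G.parent) (h' : F.colour = G.colour) :
    F = G := by
  obtain ⟨F, _, _, _⟩ := F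
  obtain ⟨G, _, _, _⟩ := G
  cases ext_parent h
  cases h'
  rfl

/-- the bijection -/
def joinE : {Fs : RootedForest (Fin n ×ₗ Fin (m+1)) // ChainUp n (m+1) Fs} ≃ KForest n (m+1) where
  toFun Fs := joinF Fs.1 Fs.2
  invFun F := ⟨splitF F, splitF_chain F⟩
  left_inv := by
    rintro ⟨Fs, H⟩
    apply Subtype.ext
    apply ext_parent
    funext p
    obtain ⟨⟨j, i⟩, rfl⟩ := toLex.surjective p
    change spar (joinF Fs H) (toLex (j, i)) = Fs.parent (toLex (j, i))
    induction i using Fin.lastCases with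
    | last =>
      rw [spar_last]
      cases hp : Fs.parent (toLex (j, Fin.last m)) with
      | none =>
        have hpar : (joinF Fs H).parent j = none := by
          change jpar Fs j = none
          rw [jpar, hp]; rfl
        rw [hpar]; rfl
      | some q =>
        obtain ⟨⟨j', i'⟩, rfl⟩ := toLex.surjective q
        have hpar : (joinF Fs H).parent j = some j' := (jpar_iff Fs j j').2 ⟨i', hp⟩
        have hcol : (joinF Fs H).colour j = m - i' := by
          simp only [joinF, hp]; rfl
        rw [hpar, Option.map_some]
        congr 2
        refine Prod.ext rfl (Fin.ext ?_)
        change m - (joinF Fs H).colour j = i'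
        omega
    | cast i => rw [spar_cast, chain Fs H]
  right_inv := by
    intro F
    apply kext
    · funext r
      change ((spar F (toLex (r, Fin.last m))).map _) = _
      rw [spar_last, Option.map_map]
      cases F.parent r <;> rfl
    · funext r
      change ((spar F (toLex (r, Fin.last m))).map _).getD 0 = _
      rw [spar_last]
      have h1 := F.colour_lt r
      cases hp : F.parent r with
      | none => exact (F.colour_root r hp).symm
      | some q =>
        change m - (m - F.colour r) = _
        omega

variable (Fs : RootedForest (Fin n ×ₗ Fin (m+1)))

theorem h_top (H : ChainUp n (m+1) Fs) (r : Fin n) :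
    Fs.h (toLex (r, Fin.last m)) = (m+1) * (joinF Fs H).toRootedForest.h r := by
  unfold RootedForest.h
  have e : Fs.hook (toLex (r, Fin.last m)) =
      Set.image toLex ((joinF Fs H).toRootedForest.hook r ×ˢ (Set.univ : Set (Fin (m+1)))) := by
    ext p
    obtain ⟨⟨j, i⟩, rfl⟩ := toLex.surjective p
    rw [mem_hook]
    constructor
    · intro h
      refine ⟨(j, i), ⟨?_, trivial⟩, rfl⟩
      rw [mem_hook]
      exact proj_path Fs H h
    · rintro ⟨⟨j', i'⟩, ⟨h, _⟩, h'⟩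
      cases h'
      rw [mem_hook] at h
      refine (to_top Fs H j i).trans ?_
      rcases reflTransGen_iff_eq_or_transGen.1 h with h | h
      · change r = j at h
        rw [h]
      · exact (lift_path Fs H h).to_reflTransGen
  rw [e, Set.ncard_image_of_injective _ toLex.injective, Set.ncard_prod, Set.ncard_univ,
    Nat.card_fin, mul_comm]

theorem h_chain (H : ChainUp n (m+1) Fs) (j : Fin n) (i : Fin (m+1)) :
    Fs.h (toLex (j, i)) = (i + 1) + ∑ r : Fin n,
      if (∃ s ≤ i, Fs.parent (toLex (r, Fin.last m)) = some (toLex (j, s)))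
        then Fs.h (toLex (r, Fin.last m)) else 0 := by
  induction i using Fin.induction with
  | zero =>
    rw [h_rec, sum_lex]
    simp only [Fin.val_zero, zero_add]
    congr 1
    refine Finset.sum_congr rfl fun r _ => ?_
    rw [Finset.sum_eq_zero, zero_add]
    · congr 1
      simp
    · intro i _
      rw [if_neg]
      rw [chain Fs H]
      intro h
      have : i.succ = 0 := congrArg (fun p => (ofLex p).2) (Option.some.inj h)
      exact Fin.succ_ne_zero _ this
  | succ i ih =>
    rw [h_rec, sum_lex, Finset.sum_add_distrib]
    have e1 : (∑ r : Fin n, ∑ t : Fin m,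
        if Fs.parent (toLex (r, t.castSucc)) = some (toLex (j, i.succ))
          then Fs.h (toLex (r, t.castSucc)) else 0) = Fs.h (toLex (j, i.castSucc)) := by
      rw [Finset.sum_eq_single j, Finset.sum_eq_single i]
      · rw [if_pos (chain Fs H j i)]
      · intro t _ ht
        rw [if_neg]
        rw [chain Fs H]
        intro h
        have : t.succ = i.succ := congrArg (fun p => (ofLex p).2) (Option.some.inj h)
        exact ht (Fin.succ_injective _ this)
      · simp
      · intro r _ hr
        refine Finset.sum_eq_zero fun t _ => ?_
        rw [if_neg]
        rw [chain Fs H]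
        intro h
        exact hr (congrArg (fun p => (ofLex p).1) (Option.some.inj h))
      · simp
    rw [e1, ih]
    have e2 : ∀ r : Fin n,
        (if (∃ s ≤ i.succ, Fs.parent (toLex (r, Fin.last m)) = some (toLex (j, s)))
          then Fs.h (toLex (r, Fin.last m)) else 0) =
        (if (∃ s ≤ i.castSucc, Fs.parent (toLex (r, Fin.last m)) = some (toLex (j, s)))
          then Fs.h (toLex (r, Fin.last m)) else 0) +
        (if Fs.parent (toLex (r, Fin.last m)) = some (toLex (j, i.succ))
          then Fs.h (toLex (r, Fin.last m)) else 0) := by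
      intro r
      by_cases h1 : Fs.parent (toLex (r, Fin.last m)) = some (toLex (j, i.succ))
      · rw [if_pos ⟨_, le_rfl, h1⟩, if_neg, if_pos h1, zero_add]
        rintro ⟨s, hs, h2⟩
        rw [h1] at h2
        have : i.succ = s := congrArg (fun p => (ofLex p).2) (Option.some.inj h2)
        rw [← this] at hs
        exact absurd hs (not_le.2 Fin.castSucc_lt_succ)
      · rw [if_neg h1, add_zero]
        congr 1
        apply propext
        constructor
        · rintro ⟨s, hs, h2⟩
          refine ⟨s, ?_, h2⟩
          have : s ≠ i.succ := by rintro rfl; exact h1 h2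
          have h3 : (s : ℕ) ≠ i + 1 := fun h => this (Fin.ext h)
          rw [Fin.le_def] at hs ⊢
          simp at hs ⊢
          omega
        · rintro ⟨s, hs, h2⟩
          exact ⟨s, hs.trans Fin.castSucc_lt_succ.le, h2⟩
    simp only [e2, Finset.sum_add_distrib, Fin.val_castSucc, Fin.val_succ]
    ring

theorem no_self (H : ChainUp n (m+1) Fs) (r : Fin n) (s : Fin (m+1)) :
    Fs.parent (toLex (r, Fin.last m)) ≠ some (toLex (r, s)) := fun h =>
  Fs.acyclic _ (TransGen.head' h (to_top Fs H r s))

theorem top_lt (H : ChainUp n (m+1) Fs) (r j : Fin n) (s : Fin (m+1))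
    (h : Fs.parent (toLex (r, Fin.last m)) = some (toLex (j, s))) :
    (toLex (r, Fin.last m) < toLex (j, s)) ↔ r < j := by
  rw [Prod.Lex.toLex_lt_toLex]
  constructor
  · rintro (h1 | ⟨h1, -⟩)
    · exact h1
    · change r = j at h1
      subst h1
      exact absurd h (no_self Fs H r s)
  · exact Or.inl

theorem lt_top' (H : ChainUp n (m+1) Fs) (r j : Fin n) (s : Fin (m+1))
    (h : Fs.parent (toLex (r, Fin.last m)) = some (toLex (j, s))) :
    (toLex (j, s) < toLex (r, Fin.last m)) ↔ j < r := by
  rw [Prod.Lex.toLex_lt_toLex]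
  constructor
  · rintro (h1 | ⟨h1, -⟩)
    · exact h1
    · change j = r at h1
      subst h1
      exact absurd h (no_self Fs H j s)
  · exact Or.inl

theorem comaj_join (H : ChainUp n (m+1) Fs) : Fs.comaj = (m+1) * (joinF Fs H).toRootedForest.comaj := by
  rw [comaj_eq, comaj_eq, sum_lex, Finset.mul_sum]
  refine Finset.sum_congr rfl fun r _ => ?_
  rw [Finset.sum_eq_zero, zero_add, h_top Fs H, mul_ite, mul_zero]
  · congr 1
    apply propext
    constructor
    · rintro ⟨⟨j, s⟩, h1, h2⟩
      exact ⟨j, (jpar_iff Fs r j).2 ⟨s, h1⟩, (lt_top' Fs H r j s h1).1 h2⟩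
    · rintro ⟨j, h1, h2⟩
      obtain ⟨s, hs⟩ := (jpar_iff Fs r j).1 h1
      exact ⟨_, hs, (lt_top' Fs H r j s hs).2 h2⟩
  · intro i _
    rw [if_neg]
    rintro ⟨u, h1, h2⟩
    rw [chain Fs H] at h1
    cases h1
    rw [Prod.Lex.toLex_lt_toLex] at h2
    rcases h2 with h2 | ⟨-, h2⟩
    · exact lt_irrefl _ h2
    · exact absurd h2 (not_lt.2 Fin.castSucc_lt_succ.le)

theorem sum_colour (H : ChainUp n (m+1) Fs) (r : Fin n) :
    (∑ j : Fin n, ∑ i : Fin m,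
      if (∃ s ≤ i.castSucc, Fs.parent (toLex (r, Fin.last m)) = some (toLex (j, s)))
        then Fs.h (toLex (r, Fin.last m)) else 0) =
      (joinF Fs H).colour r * Fs.h (toLex (r, Fin.last m)) := by
  cases hp : Fs.parent (toLex (r, Fin.last m)) with
  | none => simp [joinF, hp]
  | some p =>
    obtain ⟨⟨j, s⟩, rfl⟩ := toLex.surjective p
    have hc : (joinF Fs H).colour r = m - s := by
      simp only [joinF, hp]; rfl
    rw [hc, Finset.sum_eq_single j]
    · have : ∀ i : Fin m, (∃ s' ≤ i.castSucc,
          (some (toLex (j, s)) : Option (Fin n ×ₗ Fin (m+1))) = some (toLex (j, s'))) ↔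
          (s : ℕ) ≤ i := by
        intro i
        constructor
        · rintro ⟨s', h1, h2⟩
          have : s = s' := congrArg (fun p => (ofLex p).2) (Option.some.inj h2)
          subst this
          exact h1
        · intro h
          exact ⟨s, h, rfl⟩
      refine (Finset.sum_congr rfl fun i _ => if_congr (this i) rfl rfl).trans ?_
      rw [← Finset.sum_filter, Finset.sum_const, smul_eq_mul]
      congr 1
      have h2 := Fin.sum_univ_eq_sum_range (fun i => if (s : ℕ) ≤ i then 1 else 0) m
      rw [Finset.card_filter, h2, ← Finset.card_filter]
      have : (Finset.range m).filter (fun i => (s : ℕ) ≤ i) = Finset.Ico (s : ℕ) m := by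
        ext; simp [and_comm]
      rw [this, Nat.card_Ico]
    · intro j' _ hj
      refine Finset.sum_eq_zero fun i _ => ?_
      rw [if_neg]
      rintro ⟨s', -, h2⟩
      exact hj (congrArg (fun p => (ofLex p).1) (Option.some.inj h2)).symm
    · simp

theorem maj_join (H : ChainUp n (m+1) Fs) : Fs.maj = n * (m+1).choose 2 + (m+1) * (joinF Fs H).majk := by
  unfold KForest.majk
  rw [maj_eq, maj_eq, sum_lex, Finset.sum_add_distrib, mul_add]
  have e1 : (∑ r : Fin n, if (∃ u, Fs.parent (toLex (r, Fin.last m)) = some u ∧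
      toLex (r, Fin.last m) < u) then Fs.h (toLex (r, Fin.last m)) else 0) =
      (m+1) * ∑ v : Fin n, if (∃ u, (joinF Fs H).parent v = some u ∧ v < u) then
        (joinF Fs H).toRootedForest.h v else 0 := by
    rw [Finset.mul_sum]
    refine Finset.sum_congr rfl fun r _ => ?_
    rw [h_top Fs H, mul_ite, mul_zero]
    congr 1
    apply propext
    constructor
    · rintro ⟨⟨j, s⟩, h1, h2⟩
      exact ⟨j, (jpar_iff Fs r j).2 ⟨s, h1⟩, (top_lt Fs H r j s h1).1 h2⟩
    · rintro ⟨j, h1, h2⟩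
      obtain ⟨s, hs⟩ := (jpar_iff Fs r j).1 h1
      exact ⟨_, hs, (top_lt Fs H r j s hs).2 h2⟩
  have e2 : (∑ j : Fin n, ∑ i : Fin m, if (∃ u, Fs.parent (toLex (j, i.castSucc)) = some u ∧
      toLex (j, i.castSucc) < u) then Fs.h (toLex (j, i.castSucc)) else 0) =
      n * (m+1).choose 2 + (m+1) * (joinF Fs H).chr := by
    have : ∀ (j : Fin n) (i : Fin m), (if (∃ u, Fs.parent (toLex (j, i.castSucc)) = some u ∧
      toLex (j, i.castSucc) < u) then Fs.h (toLex (j, i.castSucc)) else 0) =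
        (i + 1) + ∑ r : Fin n,
      if (∃ s ≤ i.castSucc, Fs.parent (toLex (r, Fin.last m)) = some (toLex (j, s)))
        then Fs.h (toLex (r, Fin.last m)) else 0 := by
      intro j i
      rw [if_pos, h_chain Fs H]
      · rfl
      · refine ⟨_, chain Fs H j i, ?_⟩
        rw [Prod.Lex.toLex_lt_toLex]
        exact Or.inr ⟨rfl, Fin.castSucc_lt_succ⟩
    simp only [this, Finset.sum_add_distrib]
    rw [← Finset.sum_add_distrib]
    congr 1
    · have h3 : ∑ i : Fin m, ((i : ℕ) + 1) = (m+1).choose 2 := by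
        rw [Fin.sum_univ_eq_sum_range (fun i => i + 1) m]
        exact sum_choose m
      rw [← h3]
      simp [Finset.sum_add_distrib, mul_add]
    · have h4 : (joinF Fs H).chr = ∑ r : Fin n,
          (joinF Fs H).colour r * (joinF Fs H).toRootedForest.h r := by
        unfold KForest.chr
        rw [Finset.sum_filter]
        refine Finset.sum_congr rfl fun r _ => ?_
        by_cases hr : (joinF Fs H).parent r = none
        · rw [(joinF Fs H).colour_root r hr]; simp
        · rw [if_pos hr]
      rw [h4, Finset.mul_sum]
      have h5 : ∀ j : Fin n, (∑ i : Fin m, ∑ r : Fin n,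
        if (∃ s ≤ i.castSucc, Fs.parent (toLex (r, Fin.last m)) = some (toLex (j, s)))
          then Fs.h (toLex (r, Fin.last m)) else 0) = ∑ r : Fin n, ∑ i : Fin m, 
        if (∃ s ≤ i.castSucc, Fs.parent (toLex (r, Fin.last m)) = some (toLex (j, s)))
          then Fs.h (toLex (r, Fin.last m)) else 0 := fun j => Finset.sum_comm
      simp only [h5]
      rw [Finset.sum_comm]
      refine Finset.sum_congr rfl fun r _ => ?_
      rw [sum_colour Fs H, h_top Fs H]
      ring
  rw [e1, e2]
  ring

end Join

end JoinAux

/-- The map `join : R*_{kn} → R_n^k` — which assigns colour `k - i` to each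
edge `(j_i, r_s)` with `r ≠ j` and merges the vertices `j_1, …, j_k` into a single vertex
`j` (so that the parent of `r` is read off from the parent of the top vertex `r_k` of the
chain of `r`) — is a bijection, and for `F = join F*` one has
`maj F* = n·C(k,2) + k·maj_k F` and `comaj F* = k·comaj F`. -/
theorem stmt9 (n k : ℕ) (hn : 1 ≤ n) (hk : 1 ≤ k) :
    ∃ join : {Fs : RootedForest (Fin n ×ₗ Fin k) // ChainUp n k Fs} ≃ KForest n k,
      ∀ Fs : {Fs : RootedForest (Fin n ×ₗ Fin k) // ChainUp n k Fs},
        (∀ r : Fin n,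
          (join Fs).parent r =
            (Fs.1.parent (toLex (r, ⟨k - 1, by omega⟩))).map (fun p => (ofLex p).1)) ∧
        (∀ (r j : Fin n) (i : Fin k),
          Fs.1.parent (toLex (r, ⟨k - 1, by omega⟩)) = some (toLex (j, i)) →
            (join Fs).colour r = k - 1 - (i : ℕ)) ∧
        Fs.1.maj = n * k.choose 2 + k * KForest.majk (join Fs) ∧
        Fs.1.comaj = k * (join Fs).toRootedForest.comaj := by
  obtain ⟨m, rfl⟩ : ∃ m, k = m + 1 := ⟨k - 1, by omega⟩
  refine ⟨JoinAux.joinE, fun Fs => ⟨fun r => rfl, ?_, JoinAux.maj_join Fs.1 Fs.2,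
    JoinAux.comaj_join Fs.1 Fs.2⟩⟩
  intro r j i h
  have h' : Fs.1.parent (toLex (r, Fin.last m)) = some (toLex (j, i)) := h
  change (((Fs.1.parent (toLex (r, Fin.last m))).map
    (fun p => m - ((ofLex p).2 : ℕ))).getD 0) = _
  rw [h']
  rfl
end

section
/- Let W be a weighted coloured rooted forest on a linearly ordered vertex set and let (x,y) be an edge of W (x the parent of y) such that y < x, no vertex label lies strictly between y and x, and κ(x,y) = 0. Let W' be obtained from W by replacing each edge (y,v) with an edge (x,v) of colour κ(y,v)+1, increasing wt(x) by wt(y), and deleting vertex y and edge (x,y). Then the weighted statistics satisfy: maj̄(W') = maj̄(W) − h̄(y), comaj̄(W') = comaj̄(W), and maj̄_k(W') = maj̄_k(W) − wt(y), where maj̄_k = maj̄ + chr̄_k. -/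
/-- A weighted coloured rooted forest on a vertex set `V`: a rooted forest encoded by its
parent function (`parent v = some u` means `u` is the parent of `v`; `parent v = none`
means `v` is a root), an edge colouring `κ : E(W) → ℕ` (the colour of the edge into `v`
is recorded at `v`; the value at roots is irrelevant since no statistic uses it), and a
positive integer weight on each vertex. -/
structure WForest (V : Type) where
  parent : V → Option V
  acyclic : ∀ v : V, ¬ Relation.TransGen (fun a b : V => parent a = some b) v v
  colour : V → ℕ
  wt : V → ℕ
  wt_pos : ∀ v, 0 < wt v

namespace WForest

variable {V : Type} [Fintype V] [LinearOrder V]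

/-- `F.Desc u v` means `v` is a (strict) descendant of `u`. -/
def Desc (F : WForest V) (u v : V) : Prop :=
  Relation.TransGen (fun a b : V => F.parent a = some b) v u

/-- The weighted hook length `h̄(u) = ∑_{v ∈ H(u)} wt v`, the sum of the weights over the
hook of `u` (i.e. over `u` and all its descendants). -/
noncomputable def hbar (F : WForest V) (u : V) : ℕ :=
  ∑ᶠ v ∈ {v : V | v = u ∨ F.Desc u v}, F.wt v

/-- The weighted left hook length `h̄_L(u)`. -/
noncomputable def hbarL (F : WForest V) (u : V) : ℕ :=
  ∑ v ∈ Finset.univ.filter (fun v : V => F.parent v = some u ∧ v < u), F.hbar v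

/-- The weighted right hook length `h̄_R(u)`. -/
noncomputable def hbarR (F : WForest V) (u : V) : ℕ :=
  ∑ v ∈ Finset.univ.filter (fun v : V => F.parent v = some u ∧ u < v), F.hbar v

/-- The weighted major index `maj̄`. -/
noncomputable def majbar (F : WForest V) : ℕ := ∑ u : V, F.hbarL u

/-- The weighted comajor index `comaj̄`. -/
noncomputable def comajbar (F : WForest V) : ℕ := ∑ u : V, F.hbarR u

/-- The weighted chromatic depth `chr̄_k(W) = ∑_{(u,v) ∈ E(W)} κ(u,v)·h̄(v)`. -/
noncomputable def chrbar (F : WForest V) : ℕ :=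
  ∑ v ∈ Finset.univ.filter (fun v : V => F.parent v ≠ none), F.colour v * F.hbar v

/-- `maj̄_k = maj̄ + chr̄_k`. -/
noncomputable def majbark (F : WForest V) : ℕ := F.majbar + F.chrbar

end WForest

namespace WForest

open Classical in
theorem hbar_eq {V : Type} [Fintype V] (F : WForest V) (u : V) :
    F.hbar u = ∑ v : V, if Relation.ReflTransGen (fun a b : V => F.parent a = some b) v u
      then F.wt v else 0 := by
  unfold hbar
  rw [finsum_mem_eq_finite_toFinset_sum _ (Set.toFinite _), ← Finset.sum_filter]
  apply Finset.sum_congr _ (fun _ _ => rfl)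
  ext v
  simp only [Set.Finite.mem_toFinset, Set.mem_ofPred_eq, Finset.mem_filter, Finset.mem_univ,
    true_and, Desc]
  rw [Relation.reflTransGen_iff_eq_or_transGen]
  simp [eq_comm]

open Classical in
theorem hbar_rec {V : Type} [Fintype V] (F : WForest V) (u : V) :
    F.hbar u = F.wt u + ∑ c : V, if F.parent c = some u then F.hbar c else 0 := by
  have key : ∀ v : V, (if Relation.ReflTransGen (fun a b : V => F.parent a = some b) v u
      then F.wt v else 0) = (if v = u then F.wt v else 0) +
      ∑ c : V, if F.parent c = some u then
        (if Relation.ReflTransGen (fun a b : V => F.parent a = some b) v c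
          then F.wt v else 0) else 0 := by
    intro v
    by_cases hv : v = u
    · subst hv
      rw [if_pos Relation.ReflTransGen.refl, if_pos rfl, Finset.sum_eq_zero, add_zero]
      intro c _
      split_ifs with h1 h2
      · exact absurd (Relation.TransGen.tail' h2 h1) (F.acyclic v)
      · rfl
      · rfl
    · rw [if_neg hv, zero_add]
      by_cases h : Relation.ReflTransGen (fun a b : V => F.parent a = some b) v u
      · rw [if_pos h]
        rcases Relation.ReflTransGen.cases_tail h with h0 | ⟨c, hc, hcu⟩
        · exact absurd h0.symm hv
        · rw [Finset.sum_eq_single c]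
          · rw [if_pos hcu, if_pos hc]
          · intro d _ hdc
            split_ifs with h1 h2
            · exfalso
              have aux : ∀ c d : V, F.parent c = some u → F.parent d = some u → d ≠ c →
                  ¬ Relation.ReflTransGen (fun a b : V => F.parent a = some b) c d := by
                intro c d hc hd hne hcd
                rcases Relation.ReflTransGen.cases_head hcd with h0 | ⟨e, he, hed⟩
                · exact hne h0.symm
                · have : e = u := by
                    have := he.symm.trans hc
                    simpa using this
                  subst this
                  exact F.acyclic _ (Relation.TransGen.tail' hed hd)
              have hu : Relator.RightUnique (fun a b : V => F.parent a = some b) := by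
                intro a b c h1 h2
                have := h1.symm.trans h2
                simpa using this
              rcases Relation.ReflTransGen.total_of_right_unique hu hc h2 with h3 | h3
              · exact aux c d hcu h1 hdc h3
              · exact aux d c h1 hcu hdc.symm h3
            · rfl
            · rfl
          · intro h; exact absurd (Finset.mem_univ _) h
      · rw [if_neg h, Finset.sum_eq_zero]
        intro c _
        split_ifs with h1 h2
        · exact absurd (h2.tail h1) h
        · rfl
        · rfl
  rw [hbar_eq, Finset.sum_congr rfl (fun v _ => key v), Finset.sum_add_distrib]
  congr 1
  · simp
  · rw [Finset.sum_comm]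
    refine Finset.sum_congr rfl fun c _ => ?_
    split_ifs
    · rw [hbar_eq]
    · simp

open Classical in
theorem sum_edges {V : Type} [Fintype V] (F : WForest V) (P : V → V → Prop)
    (f : V → ℕ) : ∑ u : V, ∑ v ∈ Finset.univ.filter (fun v : V => F.parent v = some u ∧ P v u), f v
      = ∑ v : V, if ∃ u, F.parent v = some u ∧ P v u then f v else 0 := by
  simp only [Finset.sum_filter]
  rw [Finset.sum_comm]
  refine Finset.sum_congr rfl fun v _ => ?_
  cases h : F.parent v with
  | none => simp
  | some w =>
    rw [Finset.sum_eq_single w]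
    · simp
    · intro b _ hb
      simp [hb.symm]
    · simp

open Classical in
theorem majbar_eq {V : Type} [Fintype V] [LinearOrder V] (F : WForest V) :
    F.majbar = ∑ v : V, if ∃ u, F.parent v = some u ∧ v < u then F.hbar v else 0 := by
  refine Eq.trans ?_ ((sum_edges F (fun v u => v < u) F.hbar).trans
    (Finset.sum_congr rfl fun v _ => by congr))
  unfold majbar hbarL
  refine Finset.sum_congr rfl fun u _ => Finset.sum_congr ?_ fun _ _ => rfl
  ext; simp

open Classical in
theorem comajbar_eq {V : Type} [Fintype V] [LinearOrder V] (F : WForest V) :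
    F.comajbar = ∑ v : V, if ∃ u, F.parent v = some u ∧ u < v then F.hbar v else 0 := by
  refine Eq.trans ?_ ((sum_edges F (fun v u => u < v) F.hbar).trans
    (Finset.sum_congr rfl fun v _ => by congr))
  unfold comajbar hbarR
  refine Finset.sum_congr rfl fun u _ => Finset.sum_congr ?_ fun _ _ => rfl
  ext; simp

open Classical in
theorem chrbar_eq {V : Type} [Fintype V] [LinearOrder V] (F : WForest V) :
    F.chrbar = ∑ v : V, if F.parent v ≠ none then F.colour v * F.hbar v else 0 := by
  rw [← Finset.sum_filter]
  unfold chrbar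
  refine Finset.sum_congr ?_ fun _ _ => rfl
  ext; simp

theorem sum_split {V : Type} [Fintype V] [DecidableEq V] (y : V) (f : V → ℕ) :
    ∑ v : V, f v = f y + ∑ v : {v : V // v ≠ y}, f v.1 := by
  rw [← Finset.add_sum_erase Finset.univ f (Finset.mem_univ y)]
  congr 1
  exact Finset.sum_subtype _ (by simp) f

end WForest

/-- Let `W` be a weighted coloured rooted forest on a linearly ordered
vertex set and let `(x,y)` be an edge of `W` (with `x` the parent of `y`) such that
`y < x`, no vertex label lies strictly between `y` and `x`, and `κ(x,y) = 0`.  Let `W'`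
(on the vertex set `V \ {y}`) be obtained from `W` by replacing each edge `(y,v)` with an
edge `(x,v)` of colour `κ(y,v) + 1`, increasing `wt x` by `wt y`, and deleting `y`
together with the edge `(x,y)`.  Then `maj̄ W' = maj̄ W - h̄ y`, `comaj̄ W' = comaj̄ W`,
and `maj̄_k W' = maj̄_k W - wt y`. -/
theorem stmt11 (V : Type) [Fintype V] [LinearOrder V] (W : WForest V) (x y : V)
    (hedge : W.parent y = some x) (hyx : y < x)
    (hbetween : ∀ v : V, ¬ (y < v ∧ v < x))
    (hcol : W.colour y = 0)
    (W' : WForest {v : V // v ≠ y})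
    (hparent : ∀ v : {v : V // v ≠ y},
      W'.parent v = (W.parent v.1).map (fun u => if h : u = y then ⟨x, hyx.ne'⟩ else ⟨u, h⟩))
    (hcolour : ∀ v : {v : V // v ≠ y},
      W'.colour v = if W.parent v.1 = some y then W.colour v.1 + 1 else W.colour v.1)
    (hwt : ∀ v : {v : V // v ≠ y},
      W'.wt v = if v.1 = x then W.wt x + W.wt y else W.wt v.1) :
    (W'.majbar : ℤ) = (W.majbar : ℤ) - (W.hbar y : ℤ) ∧
    W'.comajbar = W.comajbar ∧
    (W'.majbark : ℤ) = (W.majbark : ℤ) - (W.wt y : ℤ) := by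
  classical
  have hxy : x ≠ y := hyx.ne'
  have hpx : W.parent x ≠ some y := fun h =>
    W.acyclic x (Relation.TransGen.tail (Relation.TransGen.single h) hedge)
  -- the collapsing map
  let f : V → {v : V // v ≠ y} := fun u => if h : u = y then ⟨x, hxy⟩ else ⟨u, h⟩
  have fy : f y = ⟨x, hxy⟩ := by simp [f]
  have fn : ∀ v : {v : V // v ≠ y}, f v.1 = v := fun v => by simp [f, v.2]
  have hp' : ∀ v : {v : V // v ≠ y}, W'.parent v = (W.parent v.1).map f := hparent
  have fwd : ∀ a b : V, Relation.ReflTransGen (fun a b : V => W.parent a = some b) a b →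
      Relation.ReflTransGen (fun a b => W'.parent a = some b) (f a) (f b) := by
    intro a b h
    induction h with
    | refl => exact Relation.ReflTransGen.refl
    | @tail c d _ hcd ih =>
      by_cases hc : c = y
      · subst hc
        have hd : x = d := by simpa using hedge.symm.trans hcd
        subst hd
        have : f x = f c := by rw [fy]; exact fn ⟨x, hxy⟩
        rw [this]; exact ih
      · refine ih.tail ?_
        have h1 : f c = ⟨c, hc⟩ := fn ⟨c, hc⟩
        rw [h1, hp', hcd]; rfl
  have bwd : ∀ a b : {v : V // v ≠ y},
      Relation.ReflTransGen (fun a b => W'.parent a = some b) a b →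
      Relation.ReflTransGen (fun a b : V => W.parent a = some b) a.1 b.1 := by
    intro a b h
    induction h with
    | refl => exact Relation.ReflTransGen.refl
    | @tail c d _ hcd ih =>
      refine ih.trans ?_
      rw [hp'] at hcd
      obtain ⟨e, he, hed⟩ := Option.map_eq_some_iff.1 hcd
      by_cases hey : e = y
      · subst hey
        rw [fy] at hed
        rw [← hed]
        exact Relation.ReflTransGen.head he (Relation.ReflTransGen.single hedge)
      · rw [← hed, show f e = ⟨e, hey⟩ from fn ⟨e, hey⟩]
        exact Relation.ReflTransGen.single he
  have riff : ∀ a b : {v : V // v ≠ y},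
      Relation.ReflTransGen (fun a b => W'.parent a = some b) a b ↔
      Relation.ReflTransGen (fun a b : V => W.parent a = some b) a.1 b.1 := by
    intro a b
    refine ⟨bwd a b, fun h => ?_⟩
    have := fwd _ _ h
    rwa [fn, fn] at this
  have yiff : ∀ b : {v : V // v ≠ y},
      Relation.ReflTransGen (fun a b : V => W.parent a = some b) y b.1 ↔
      Relation.ReflTransGen (fun a b : V => W.parent a = some b) x b.1 := by
    intro b
    refine ⟨fun h => ?_, fun h => h.head hedge⟩
    rcases Relation.ReflTransGen.cases_head h with h0 | ⟨e, he, heb⟩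
    · exact absurd h0.symm b.2
    · have : x = e := by simpa using hedge.symm.trans he
      rwa [this]
  have hh : ∀ u : {v : V // v ≠ y}, W'.hbar u = W.hbar u.1 := by
    intro u
    rw [WForest.hbar_eq, WForest.hbar_eq, WForest.sum_split y]
    have key : ∀ v : {v : V // v ≠ y},
        (if Relation.ReflTransGen (fun a b => W'.parent a = some b) v u then W'.wt v else 0) =
        (if v = ⟨x, hxy⟩ then (if Relation.ReflTransGen (fun a b : V => W.parent a = some b) y u.1
          then W.wt y else 0) else 0) +
        (if Relation.ReflTransGen (fun a b : V => W.parent a = some b) v.1 u.1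
          then W.wt v.1 else 0) := by
      intro v
      rw [hwt]
      by_cases hv : v = ⟨x, hxy⟩
      · subst hv
        simp only [riff, yiff, if_true]
        split_ifs <;> omega
      · have hv' : v.1 ≠ x := fun h => hv (Subtype.ext h)
        simp only [riff, if_neg hv, if_neg hv', zero_add]
    rw [Finset.sum_congr rfl (fun v _ => key v), Finset.sum_add_distrib]
    congr 1
    simp
  have hlt : ∀ v : {v : V // v ≠ y}, (∃ u, W'.parent v = some u ∧ v < u) ↔
      (∃ u, W.parent v.1 = some u ∧ v.1 < u) := by
    intro v
    rw [hp']
    cases hv : W.parent v.1 with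
    | none => simp
    | some w =>
      by_cases hw : w = y
      · subst hw
        simp only [Option.map_some, fy, Option.some.injEq, exists_eq_left']
        rw [← Subtype.coe_lt_coe]
        constructor
        · intro h
          exact lt_of_le_of_ne (not_lt.1 fun h' => hbetween v.1 ⟨h', h⟩) v.2
        · intro h; exact h.trans hyx
      · simp only [Option.map_some, Option.some.injEq, exists_eq_left',
          show f w = ⟨w, hw⟩ from fn ⟨w, hw⟩]
        rw [← Subtype.coe_lt_coe]
  have hgt : ∀ v : {v : V // v ≠ y}, (∃ u, W'.parent v = some u ∧ u < v) ↔
      (∃ u, W.parent v.1 = some u ∧ u < v.1) := by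
    intro v
    rw [hp']
    cases hv : W.parent v.1 with
    | none => simp
    | some w =>
      by_cases hw : w = y
      · subst hw
        simp only [Option.map_some, fy, Option.some.injEq, exists_eq_left']
        rw [← Subtype.coe_lt_coe]
        constructor
        · intro h; exact hyx.trans h
        · intro h
          refine lt_of_le_of_ne (not_lt.1 fun h' => hbetween v.1 ⟨h, h'⟩) ?_
          intro h'
          apply hpx
          change x = v.1 at h'
          rw [h']; exact hv
      · simp only [Option.map_some, Option.some.injEq, exists_eq_left',
          show f w = ⟨w, hw⟩ from fn ⟨w, hw⟩]
        rw [← Subtype.coe_lt_coe]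
  have hmaj : W.majbar = W.hbar y + W'.majbar := by
    rw [WForest.majbar_eq, WForest.majbar_eq, WForest.sum_split y]
    simp only [hlt, hh]
    rw [if_pos ⟨x, hedge, hyx⟩]
  have hcomaj : W'.comajbar = W.comajbar := by
    rw [WForest.comajbar_eq, WForest.comajbar_eq, WForest.sum_split y]
    simp only [hgt, hh]
    rw [if_neg, zero_add]
    rintro ⟨u, hu, huy⟩
    have : x = u := by simpa using hedge.symm.trans hu
    subst this
    exact lt_asymm hyx huy
  have hchr : W'.chrbar + W.wt y = W.chrbar + W.hbar y := by
    have hr := WForest.hbar_rec W y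
    rw [WForest.sum_split y, if_neg (by rw [hedge]; simpa using hxy), zero_add] at hr
    have hr' : W.hbar y = W.wt y + ∑ v : {v : V // v ≠ y},
        if W.parent v.1 = some y then W.hbar v.1 else 0 := by convert hr
    rw [hr', WForest.chrbar_eq, WForest.chrbar_eq, WForest.sum_split y (fun v => ite _ _ _), hcol]
    have key : ∀ v : {v : V // v ≠ y},
        (if W'.parent v ≠ none then W'.colour v * W'.hbar v else 0) =
        (if W.parent v.1 ≠ none then W.colour v.1 * W.hbar v.1 else 0) +
        (if W.parent v.1 = some y then W.hbar v.1 else 0) := by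
      intro v
      rw [hh, hcolour, hp']
      cases hv : W.parent v.1 with
      | none => simp
      | some w =>
        by_cases hw : w = y
        · simp [hw, add_mul]
        · simp [hw]
    rw [Finset.sum_congr rfl (fun v _ => key v), Finset.sum_add_distrib]
    simp only [zero_mul, ite_self, zero_add]
    omega
  refine ⟨by omega, hcomaj, ?_⟩
  unfold WForest.majbark
  push_cast
  omega
end

section
/- For all n, k ≥ 1, the long cycle σ_{kn} = (0 1 2 ⋯ kn) in the symmetric group on {0,1,…,kn} cannot be written as a left-to-right product of fewer than n permutations each of which is a (k+1)-cycle. -/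
/-- For all `n, k ≥ 1`, the long cycle `σ_{kn} = (0 1 2 ⋯ kn)` in the
symmetric group on `{0,1,…,kn}` cannot be written as a left-to-right product of fewer
than `n` permutations each of which is a `(k+1)`-cycle.  (Left-to-right product of
`(τ_1,…,τ_m)` means `τ_1` is applied first, i.e. the reversed product in Mathlib's
convention; `σ_{kn}` is `finRotate (kn+1)`, and a `(k+1)`-cycle is a cyclic permutation
whose support has exactly `k+1` elements.) -/
theorem stmt12 (n k : ℕ) (hn : 1 ≤ n) (hk : 1 ≤ k) (m : ℕ) (hm : m < n)
    (τ : Fin m → Equiv.Perm (Fin (k * n + 1)))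
    (hτ : ∀ i, (τ i).IsCycle ∧ (τ i).support.card = k + 1) :
    (List.ofFn τ).reverse.prod ≠ finRotate (k * n + 1) := by
  intro hprod
  have hx : ∀ i, ∃ x, x ∈ (τ i).support := fun i => by
    apply Finset.card_pos.mp
    have := (hτ i).2
    omega
  choose c hc using hx
  let T : (Fin (k * n + 1) → ℚ) →ₗ[ℚ]
      (ℚ × ((Σ i : Fin m, {x // x ∈ (τ i).support.erase (c i)}) → ℚ)) :=
    { toFun := fun f => (f 0, fun p => f p.2.1 - f (c p.1))
      map_add' := by
        intro f g
        ext p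
        · simp
        · simp only [Pi.add_apply, Prod.snd_add]
          ring
      map_smul' := by
        intro a f
        ext p
        · simp
        · simp only [Pi.smul_apply, Prod.smul_snd, smul_eq_mul, RingHom.id_apply]
          ring }
  have hcard : Fintype.card (Σ i : Fin m, {x // x ∈ (τ i).support.erase (c i)}) = m * k := by
    rw [Fintype.card_sigma]
    have : ∀ i : Fin m, Fintype.card {x // x ∈ (τ i).support.erase (c i)} = k := by
      intro i
      rw [Fintype.card_coe, Finset.card_erase_of_mem (hc i), (hτ i).2]
      rfl
    simp only [this]
    simp
  have hker : LinearMap.ker T ≠ ⊥ := by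
    apply LinearMap.ker_ne_bot_of_finrank_lt
    rw [Module.finrank_prod, Module.finrank_fintype_fun_eq_card,
      Module.finrank_fintype_fun_eq_card, hcard, Module.finrank_self, Fintype.card_fin]
    nlinarith
  obtain ⟨f, hf, hf0⟩ := (Submodule.ne_bot_iff _).mp hker
  have hf' : T f = 0 := hf
  have h0 : f 0 = 0 := congrArg Prod.fst hf'
  have hs : ∀ i, ∀ x ∈ (τ i).support, f x = f (c i) := by
    intro i x hx
    by_cases hxc : x = c i
    · rw [hxc]
    · have h := congrFun (congrArg Prod.snd hf') ⟨i, ⟨x, Finset.mem_erase.mpr ⟨hxc, hx⟩⟩⟩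
      exact sub_eq_zero.mp h
  have hinv : ∀ i y, f (τ i y) = f y := by
    intro i y
    by_cases hy : y ∈ (τ i).support
    · rw [hs i y hy, hs i _ (Equiv.Perm.apply_mem_support.mpr hy)]
    · rw [Equiv.Perm.notMem_support.mp hy]
  have hlist : ∀ l : List (Equiv.Perm (Fin (k * n + 1))),
      (∀ g ∈ l, ∀ y, f (g y) = f y) → ∀ y, f (l.prod y) = f y := by
    intro l
    induction l with
    | nil => intro _ y; simp
    | cons g l ih =>
      intro h y
      rw [List.prod_cons, Equiv.Perm.mul_apply, h g (by simp)]
      exact ih (fun g' hg' => h g' (by simp [hg'])) y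
  have hrot : ∀ y, f (finRotate (k * n + 1) y) = f y := by
    rw [← hprod]
    apply hlist
    intro g hg
    rw [List.mem_reverse, List.mem_ofFn] at hg
    obtain ⟨i, rfl⟩ := hg
    exact hinv i
  apply hf0
  funext y
  induction y using Fin.induction with
  | zero => exact h0
  | succ i ih =>
    have h := hrot i.castSucc
    rw [finRotate_succ_apply, Fin.coeSucc_eq_succ] at h
    rw [h, ih]
    rfl
end

section
/- For all n, k ≥ 1, the number of minimal k-factorizations of the long cycle σ_{kn} is |F_n^k| = (kn+1)^{n−1}. -/
namespace KFactAux

open Equiv Equiv.Perm Finset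

/-- The cycle `(e 0, e 1, …, e k)`. -/
def cyc {V : Type} [DecidableEq V] {k : ℕ} (e : Fin (k+1) → V) : Perm V := (List.ofFn e).formPerm

theorem cyc_apply {V : Type} [DecidableEq V] {k : ℕ} {e : Fin (k+1) → V}
    (he : Function.Injective e) (i : Fin (k+1)) : cyc e (e i) = e (i+1) := by
  have h := List.formPerm_apply_getElem (List.ofFn e) (List.nodup_ofFn.2 he) i
    (by rw [List.length_ofFn]; exact i.2)
  simp only [List.getElem_ofFn, List.length_ofFn] at h
  unfold cyc
  rw [h]
  congr 1
  ext
  simp [Fin.val_add]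

theorem cyc_fix {V : Type} [DecidableEq V] {k : ℕ} {e : Fin (k+1) → V} {x : V}
    (hx : ∀ i, e i ≠ x) : cyc e x = x := by
  apply List.formPerm_apply_of_notMem
  rw [List.mem_ofFn]
  rintro ⟨i, hi⟩
  exact hx i hi

theorem cyc_conj {V : Type} [DecidableEq V] {k : ℕ} {e : Fin (k+1) → V}
    (he : Function.Injective e) (g : Perm V) : cyc (g ∘ e) = g * cyc e * g⁻¹ := by
  ext x
  by_cases h : ∃ i, g (e i) = x
  · obtain ⟨i, rfl⟩ := h
    have := cyc_apply (g.injective.comp he) i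
    simp only [Function.comp_apply] at this
    simp [this, cyc_apply he]
  · push Not at h
    rw [cyc_fix (e := g ∘ e) h]
    have : cyc e (g⁻¹ x) = g⁻¹ x := cyc_fix (fun i hi => h i (by simp [hi]))
    rw [Perm.mul_apply, Perm.mul_apply, this, ← Perm.mul_apply, mul_inv_cancel, Perm.one_apply]

theorem cyc_rot {V : Type} [DecidableEq V] {k : ℕ} {e : Fin (k+1) → V}
    (he : Function.Injective e) (r : Fin (k+1)) : cyc (fun i => e (i + r)) = cyc e := by
  have he' : Function.Injective (fun i => e (i + r)) := he.comp (add_left_injective r)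
  ext x
  by_cases h : ∃ i, e i = x
  · obtain ⟨i, rfl⟩ := h
    have h1 := cyc_apply he' (i - r)
    simp only [sub_add_cancel] at h1
    rw [h1, cyc_apply he]
    congr 1
    abel
  · push Not at h
    rw [cyc_fix h, cyc_fix (fun i => h _)]

/-- The left-to-right product of the cycles. -/
def prd {V : Type} [DecidableEq V] {k s : ℕ} (E : Fin s → Fin (k+1) → V) : Perm V :=
  (List.ofFn (fun j => cyc (E j))).reverse.prod

theorem prd_zero {V : Type} [DecidableEq V] {k : ℕ} (E : Fin 0 → Fin (k+1) → V) : prd E = 1 := by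
  simp [prd]

theorem prd_succ {V : Type} [DecidableEq V] {k s : ℕ} (E : Fin (s+1) → Fin (k+1) → V) :
    prd E = prd (fun j => E j.succ) * cyc (E 0) := by
  simp [prd, List.ofFn_succ]

theorem prd_conj {V : Type} [DecidableEq V] {k s : ℕ} (E : Fin s → Fin (k+1) → V)
    (hE : ∀ j, Function.Injective (E j)) (g : Perm V) :
    prd (fun j => g ∘ E j) = g * prd E * g⁻¹ := by
  induction s with
  | zero => simp [prd_zero]
  | succ s ih =>
    rw [prd_succ, prd_succ, ih _ (fun j => hE _), cyc_conj (hE 0)]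
    group

/-- Merge the colours `g i` into the single colour `g 0`. -/
noncomputable def merge {V : Type} {k : ℕ} (φ : V → V) (g : Fin (k+1) → V) (x : V) : V :=
  open Classical in if ∃ i, g i = φ x then g 0 else φ x

/-- Each successive edge meets `k+1` different classes. -/
def GoodSeq {V : Type} {k : ℕ} : (s : ℕ) → (V → V) → (Fin s → Fin (k+1) → V) → Prop
  | 0, _, _ => True
  | s+1, φ, E => Function.Injective (φ ∘ E 0) ∧
      GoodSeq s (merge φ (φ ∘ E 0)) (fun j => E j.succ)

theorem sameCycle_step {V : Type} [Fintype V] [DecidableEq V] {k : ℕ} {p : Perm V}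
    {φ : V → V} (hφ : ∀ x y, φ x = φ y ↔ SameCycle p x y) {e : Fin (k+1) → V}
    (he : Function.Injective (φ ∘ e)) (i : Fin (k+1)) (t : ℕ) :
    ∀ y, (p ^ (t+1)) y = e i → SameCycle (cyc e * p) y (e (i+1)) := by
  have hei : Function.Injective e := Function.Injective.of_comp he
  induction t with
  | zero =>
    intro y hy
    rw [zero_add, pow_one] at hy
    refine ⟨1, ?_⟩
    simp [hy, cyc_apply hei]
  | succ t ih =>
    intro y hy
    by_cases hpy : p y = e i
    · refine ⟨1, ?_⟩
      simp [hpy, cyc_apply hei]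
    · have h1 := ih (p y) (by rw [← hy, pow_succ p (t+1)]; rfl)
      have hc : cyc e (p y) = p y := by
        apply cyc_fix
        intro j hj
        have : φ (e j) = φ (e i) := by
          rw [hφ, hj, ← hy]
          exact ⟨(t+1 : ℕ), by rw [zpow_natCast, pow_succ p (t+1)]; rfl⟩
        have hji : j = i := he this
        exact hpy (by rw [← hj, hji])
      have h2 : SameCycle (cyc e * p) y (p y) := ⟨1, by simp [hc]⟩
      exact h2.trans h1

theorem sameCycle_next {V : Type} [Fintype V] [DecidableEq V] {k : ℕ} {p : Perm V}
    {φ : V → V} (hφ : ∀ x y, φ x = φ y ↔ SameCycle p x y) {e : Fin (k+1) → V}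
    (he : Function.Injective (φ ∘ e)) (i : Fin (k+1)) (y : V) (hy : φ y = φ (e i)) :
    SameCycle (cyc e * p) y (e (i+1)) := by
  obtain ⟨t, ht, -, h⟩ := ((hφ _ _).1 hy).exists_pow_eq''
  obtain ⟨t, rfl⟩ : ∃ u, t = u + 1 := ⟨t - 1, by omega⟩
  exact sameCycle_step hφ he i t y h

theorem merge_inv {V : Type} [DecidableEq V] {k : ℕ} {p : Perm V}
    {φ : V → V} (hφ : ∀ x, φ (p x) = φ x) {e : Fin (k+1) → V}
    (he : Function.Injective e) (x : V) :
    merge φ (φ ∘ e) ((cyc e * p) x) = merge φ (φ ∘ e) x := by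
  have h1 : merge φ (φ ∘ e) (p x) = merge φ (φ ∘ e) x := by simp [merge, hφ]
  rw [← h1, Perm.mul_apply]
  generalize p x = y
  by_cases h : ∃ i, e i = y
  · obtain ⟨i, rfl⟩ := h
    rw [cyc_apply he]
    simp only [merge, Function.comp]
    rw [if_pos ⟨_, rfl⟩, if_pos ⟨_, rfl⟩]
  · push Not at h
    rw [cyc_fix h]

theorem inv_sameCycle {V : Type} {p : Perm V}
    {φ : V → V} (hφ : ∀ x, φ (p x) = φ x) {x y : V} (h : SameCycle p x y) : φ x = φ y := by
  obtain ⟨i, rfl⟩ := h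
  induction i using Int.induction_on with
  | zero => simp
  | succ i ih => rw [add_comm, zpow_add, zpow_one, Perm.mul_apply, hφ, ih]
  | pred i ih =>
    rw [ih, sub_eq_add_neg, add_comm, zpow_add, Perm.mul_apply, zpow_neg_one]
    generalize (p ^ (-(i:ℤ))) x = z
    have := hφ (p⁻¹ z)
    rw [← Perm.mul_apply, mul_inv_cancel, Perm.one_apply] at this
    exact this

theorem merge_sameCycle {V : Type} [Fintype V] [DecidableEq V] {k : ℕ} {p : Perm V}
    {φ : V → V} (hφ : ∀ x y, φ x = φ y ↔ SameCycle p x y) {e : Fin (k+1) → V}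
    (he : Function.Injective (φ ∘ e)) (x y : V) :
    merge φ (φ ∘ e) x = merge φ (φ ∘ e) y ↔ SameCycle (cyc e * p) x y := by
  have hei : Function.Injective e := Function.Injective.of_comp he
  have hinv : ∀ x, φ (p x) = φ x := fun x => (hφ _ _).2 ⟨-1, by simp⟩
  constructor
  · intro h
    have key : ∀ z i, φ (e i) = φ z → SameCycle (cyc e * p) z (e 0) := by
      have h0 : ∀ i : Fin (k+1), SameCycle (cyc e * p) (e i) (e 0) := by
        intro i
        induction i using Fin.induction with
        | zero => exact SameCycle.refl _ _
        | succ i ih =>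
          have := sameCycle_next hφ he i.castSucc (e i.castSucc) rfl
          rw [Fin.coeSucc_eq_succ] at this
          exact this.symm.trans ih
      intro z i hz
      exact (sameCycle_next hφ he i z hz.symm).trans (h0 _)
    simp only [merge, Function.comp] at h
    split_ifs at h with h1 h2 h2
    · obtain ⟨i, hi⟩ := h1
      obtain ⟨j, hj⟩ := h2
      exact (key _ _ hi).trans (key _ _ hj).symm
    · exact absurd ⟨0, h⟩ h2
    · exact absurd ⟨0, h.symm⟩ h1
    · obtain ⟨t, -, -, ht⟩ := ((hφ _ _).1 h).exists_pow_eq''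
      have : ∀ t : ℕ, ((cyc e * p) ^ t) x = (p ^ t) x := by
        intro t
        induction t with
        | zero => simp
        | succ t ih =>
          rw [pow_succ', Perm.mul_apply, ih, Perm.mul_apply, pow_succ', Perm.mul_apply]
          apply cyc_fix
          intro i hi
          apply h1
          refine ⟨i, ?_⟩
          rw [hi, hinv]
          exact ((hφ _ _).2 ⟨t, by simp⟩).symm
      exact ⟨t, by rw [zpow_natCast, this, ht]⟩
  · exact inv_sameCycle (merge_inv hinv hei)

theorem image_merge {V : Type} [Fintype V] [DecidableEq V] {k : ℕ} (φ : V → V)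
    (g : Fin (k+1) → V) (hg : ∀ i, g i ∈ univ.image φ) :
    univ.image (merge φ g) = insert (g 0) (univ.image φ \ univ.image g) := by
  ext r
  simp only [mem_image, mem_univ, true_and, mem_insert, mem_sdiff, not_exists]
  constructor
  · rintro ⟨x, rfl⟩
    unfold merge
    split_ifs with h
    · exact Or.inl rfl
    · exact Or.inr ⟨⟨x, rfl⟩, fun i hi => h ⟨i, hi⟩⟩
  · rintro (rfl | ⟨⟨x, rfl⟩, h⟩)
    · obtain ⟨x, -, hx⟩ := mem_image.1 (hg 0)
      exact ⟨x, by unfold merge; rw [if_pos ⟨0, hx.symm⟩]⟩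
    · exact ⟨x, by unfold merge; rw [if_neg (by simpa using h)]⟩

theorem card_image_merge {V : Type} [Fintype V] [DecidableEq V] {k : ℕ} (φ : V → V)
    (g : Fin (k+1) → V) (hg : ∀ i, g i ∈ univ.image φ) :
    (univ.image (merge φ g)).card + (univ.image g).card = (univ.image φ).card + 1 := by
  rw [image_merge φ g hg, card_insert_of_notMem (by simp)]
  have hs : univ.image g ⊆ univ.image φ := by
    intro r hr
    obtain ⟨i, -, rfl⟩ := mem_image.1 hr
    exact hg i
  have := card_sdiff_add_card_eq_card hs
  omega

theorem good_transitive {V : Type} [Fintype V] [DecidableEq V] {k s : ℕ} {p : Perm V}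
    {φ : V → V} (hφ : ∀ x y, φ x = φ y ↔ SameCycle p x y) (E : Fin s → Fin (k+1) → V)
    (hE : GoodSeq s φ E) (hc : (univ.image φ).card = k * s + 1) :
    (∀ j, Function.Injective (E j)) ∧ ∀ x y, SameCycle (prd E * p) x y := by
  induction s generalizing p φ with
  | zero =>
    refine ⟨fun j => j.elim0, fun x y => ?_⟩
    rw [prd_zero, one_mul, ← hφ]
    exact card_le_one.1 (by omega) _ (mem_image_of_mem _ (mem_univ _)) _
      (mem_image_of_mem _ (mem_univ _))
  | succ s ih =>
    obtain ⟨h1, h2⟩ := hE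
    have := card_image_merge φ (φ ∘ E 0) (fun i => mem_image_of_mem _ (mem_univ _))
    rw [card_image_of_injective _ h1, hc, card_univ, Fintype.card_fin] at this
    obtain ⟨h3, h4⟩ := ih (merge_sameCycle hφ h1) _ h2 (by rw [mul_add] at this; omega)
    refine ⟨fun j => ?_, ?_⟩
    · induction j using Fin.cases with
      | zero => exact Function.Injective.of_comp h1
      | succ j => exact h3 j
    · rw [prd_succ, mul_assoc]
      exact h4

theorem transitive_good {V : Type} [Fintype V] [DecidableEq V] {k s : ℕ} {p : Perm V}
    {φ : V → V} (hφ : ∀ x, φ (p x) = φ x) (E : Fin s → Fin (k+1) → V)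
    (hE : ∀ j, Function.Injective (E j)) (ht : ∀ x y, SameCycle (prd E * p) x y) :
    (univ.image φ).card ≤ k * s + 1 ∧
      ((univ.image φ).card = k * s + 1 → GoodSeq s φ E) := by
  induction s generalizing p φ with
  | zero =>
    refine ⟨?_, fun _ => trivial⟩
    rw [mul_zero, zero_add, card_le_one]
    intro a ha b hb
    obtain ⟨x, -, rfl⟩ := mem_image.1 ha
    obtain ⟨y, -, rfl⟩ := mem_image.1 hb
    have := ht x y
    rw [prd_zero, one_mul] at this
    exact inv_sameCycle hφ this
  | succ s ih =>
    have := card_image_merge φ (φ ∘ E 0) (fun i => mem_image_of_mem _ (mem_univ _))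
    rw [prd_succ, mul_assoc] at ht
    obtain ⟨h3, h4⟩ := ih (merge_inv hφ (hE 0)) _ (fun j => hE _) ht
    have hle : (univ.image (φ ∘ E 0)).card ≤ k + 1 := by
      simpa using card_image_le (s := univ) (f := φ ∘ E 0)
    have hms : k * (s + 1) = k * s + k := by ring
    refine ⟨by omega, fun hc => ⟨?_, h4 (by omega)⟩⟩
    have h5 : (univ.image (φ ∘ E 0)).card = (univ : Finset (Fin (k+1))).card := by
      rw [card_univ, Fintype.card_fin]; omega
    have := card_image_iff.1 h5
    simpa using this

theorem sum_embedding {Q : Type} [Fintype Q] [DecidableEq Q] {k : ℕ} (f : Q → ℕ)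
    (i : Fin (k+1)) :
    ∑ g : Fin (k+1) ↪ Q, f (g i) = (Fintype.card Q - 1).descFactorial k * ∑ q, f q := by
  classical
  have hconst : ∀ q r : Q, (univ.filter (fun g : Fin (k+1) ↪ Q => g i = q)).card =
      (univ.filter (fun g : Fin (k+1) ↪ Q => g i = r)).card := by
    intro q r
    refine card_nbij' (fun g => g.trans (swap q r).toEmbedding)
      (fun g => g.trans (swap q r).toEmbedding) ?_ ?_ ?_ ?_
    · intro g hg
      simp at hg ⊢
      simp [hg]
    · intro g hg
      simp at hg ⊢
      simp [hg]
    · intro g hg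
      ext; simp
    · intro g hg
      ext; simp
  have hcard : ∀ q : Q, (univ.filter (fun g : Fin (k+1) ↪ Q => g i = q)).card =
      (Fintype.card Q - 1).descFactorial k := by
    intro q
    have h1 := card_eq_sum_card_fiberwise (f := fun g : Fin (k+1) ↪ Q => g i)
      (s := univ) (t := univ) (by intro _ _; simp)
    rw [sum_congr rfl (fun r _ => hconst r q), sum_const, card_univ, card_univ,
      Fintype.card_embedding_eq, Fintype.card_fin, smul_eq_mul] at h1
    have hpos : 0 < Fintype.card Q := Fintype.card_pos_iff.2 ⟨q⟩
    obtain ⟨m, hm⟩ : ∃ m, Fintype.card Q = m + 1 := ⟨_, (Nat.succ_pred_eq_of_pos hpos).symm⟩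
    rw [hm, Nat.succ_descFactorial_succ] at h1
    rw [hm, Nat.add_sub_cancel]
    exact (Nat.eq_of_mul_eq_mul_left (Nat.succ_pos m) h1).symm
  rw [← sum_fiberwise univ (fun g : Fin (k+1) ↪ Q => g i), mul_sum]
  refine sum_congr rfl fun q _ => ?_
  rw [sum_congr rfl (g := fun _ => f q) (fun g hg => by rw [(mem_filter.1 hg).2]), sum_const,
    hcard, smul_eq_mul]

/-- Size of the class of colour `r`. -/
def fib {V : Type} [Fintype V] [DecidableEq V] (φ : V → V) (r : V) : ℕ :=
  (univ.filter (fun x => φ x = r)).card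

/-- Product of the class sizes. -/
def wt {V : Type} [Fintype V] [DecidableEq V] (φ : V → V) : ℕ := ∏ r ∈ univ.image φ, fib φ r

theorem wt_merge {V : Type} [Fintype V] [DecidableEq V] {k : ℕ} (φ : V → V)
    (g : Fin (k+1) → V) (hg : ∀ i, g i ∈ univ.image φ) (hi : Function.Injective g) :
    (∏ i, fib φ (g i)) * wt (merge φ g) = wt φ * ∑ i, fib φ (g i) := by
  have hs : univ.image g ⊆ univ.image φ := by
    intro r hr
    obtain ⟨i, -, rfl⟩ := mem_image.1 hr
    exact hg i
  have h0 : fib (merge φ g) (g 0) = ∑ i, fib φ (g i) := by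
    unfold fib
    rw [← card_biUnion]
    · congr 1
      ext x
      simp only [mem_filter, mem_univ, true_and, mem_biUnion]
      unfold merge
      split_ifs with h
      · simp only [true_iff]
        obtain ⟨i, hi⟩ := h
        exact ⟨i, hi.symm⟩
      · constructor
        · intro h'; exact ⟨0, h'⟩
        · rintro ⟨i, hi⟩; exact absurd ⟨i, hi.symm⟩ h
    · intro i _ j _ hij
      rw [Function.onFun, disjoint_left]
      intro x hx hy
      simp only [mem_filter, mem_univ, true_and] at hx hy
      exact hij (hi (hx.symm.trans hy))
  have h1 : ∀ r ∈ univ.image φ \ univ.image g, fib (merge φ g) r = fib φ r := by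
    intro r hr
    have hr2 : ∀ i, g i ≠ r := by simpa using (mem_sdiff.1 hr).2
    unfold fib
    congr 1
    ext x
    simp only [mem_filter, mem_univ, true_and]
    unfold merge
    split_ifs with h
    · obtain ⟨i, hi⟩ := h
      rw [← hi]
      simp [hr2]
    · rfl
  have h2 : wt φ = (∏ i, fib φ (g i)) * ∏ r ∈ univ.image φ \ univ.image g, fib φ r := by
    unfold wt
    rw [← prod_sdiff hs, mul_comm, prod_image (fun _ _ _ _ h => hi h)]
  rw [h2]
  unfold wt
  rw [image_merge φ g hg, prod_insert (by simp), h0, prod_congr rfl h1]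
  ring

theorem sum_wt_merge {V : Type} [Fintype V] [DecidableEq V] {k : ℕ} (φ : V → V) :
    ∑ e : {e : Fin (k+1) → V // Function.Injective (φ ∘ e)}, wt (merge φ (φ ∘ e.1)) =
      wt φ * (Fintype.card V * ((k+1) * ((univ.image φ).card - 1).descFactorial k)) := by
  classical
  have hQ : Fintype.card ↥(univ.image φ) = (univ.image φ).card := Fintype.card_coe _
  have hV : ∑ q : ↥(univ.image φ), fib φ q.1 = Fintype.card V := by
    rw [← card_univ (α := V), card_eq_sum_card_image φ univ]
    exact sum_coe_sort (univ.image φ) (fun r => fib φ r)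
  let F : {e : Fin (k+1) → V // Function.Injective (φ ∘ e)} → (Fin (k+1) ↪ ↥(univ.image φ)) := fun e =>
    ⟨fun i => ⟨φ (e.1 i), mem_image_of_mem _ (mem_univ _)⟩, fun i j h =>
      e.2 (congrArg Subtype.val h)⟩
  have hfib : ∀ g : Fin (k+1) ↪ ↥(univ.image φ), (univ.filter (fun e => F e = g)).card =
      ∏ i, fib φ (g i).1 := by
    intro g
    unfold fib
    rw [← Fintype.card_piFinset]
    refine card_bij (fun e _ => e.1) ?_ ?_ ?_
    · intro e he
      simp only [mem_filter, mem_univ, true_and] at he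
      subst he
      simp only [Fintype.mem_piFinset, mem_filter, mem_univ, true_and]
      intro i
      rfl
    · intro a _ b _ h
      exact Subtype.ext h
    · intro e he
      simp only [Fintype.mem_piFinset, mem_filter, mem_univ, true_and] at he
      refine ⟨⟨e, ?_⟩, ?_, rfl⟩
      · intro i j h
        simp only [Function.comp, he] at h
        exact g.injective (Subtype.ext h)
      · simp only [mem_filter, mem_univ, true_and]
        ext i
        exact he i
  rw [← sum_fiberwise univ F]
  have hstep : ∀ g : Fin (k+1) ↪ ↥(univ.image φ),
      ∑ e ∈ univ.filter (fun e => F e = g), wt (merge φ (φ ∘ e.1)) =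
        wt φ * ∑ i, fib φ (g i).1 := by
    intro g
    rw [sum_congr rfl (g := fun _ => wt (merge φ (fun i => (g i).1)))]
    · rw [sum_const, smul_eq_mul, hfib]
      exact wt_merge φ (fun i => (g i).1) (fun i => (g i).2)
        (Subtype.val_injective.comp g.injective)
    · intro e he
      rw [← (mem_filter.1 he).2]
      rfl
  rw [sum_congr rfl (fun g _ => hstep g), ← mul_sum, sum_comm,
    sum_congr rfl (fun i _ => sum_embedding (fun q : ↥(univ.image φ) => fib φ q.1) i), sum_const, hV, hQ]
  simp only [card_univ, Fintype.card_fin, smul_eq_mul]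
  ring

theorem card_good {V : Type} [Fintype V] [DecidableEq V] {k s : ℕ} (φ : V → V)
    (hc : (univ.image φ).card = k * s + 1) :
    Fintype.card V * Nat.card {E : Fin s → Fin (k+1) → V // GoodSeq s φ E} =
      wt φ * (Fintype.card V ^ s * ((k * s).factorial * (k+1) ^ s)) := by
  classical
  induction s generalizing φ with
  | zero =>
    obtain ⟨r, hr⟩ := card_eq_one.1 (by simpa using hc)
    have h1 : Nat.card {E : Fin 0 → Fin (k+1) → V // GoodSeq 0 φ E} = 1 := by
      rw [Nat.card_eq_one_iff_unique]
      exact ⟨⟨fun a b => Subtype.ext (Subsingleton.elim _ _)⟩, ⟨⟨fun j => j.elim0, trivial⟩⟩⟩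
    have h2 : fib φ r = Fintype.card V := by
      unfold fib
      rw [filter_true_of_mem, card_univ]
      intro x _
      have : φ x ∈ univ.image φ := mem_image_of_mem _ (mem_univ _)
      simpa [hr] using this
    rw [h1, wt, hr, prod_singleton, h2]
    simp
  | succ s ih =>
    let eqv : {E : Fin (s+1) → Fin (k+1) → V // GoodSeq (s+1) φ E} ≃
        Σ e : {e : Fin (k+1) → V // Function.Injective (φ ∘ e)},
          {E : Fin s → Fin (k+1) → V // GoodSeq s (merge φ (φ ∘ e.1)) E} :=
      { toFun := fun E => ⟨⟨E.1 0, E.2.1⟩, ⟨fun j => E.1 j.succ, E.2.2⟩⟩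
        invFun := fun x => ⟨Fin.cons x.1.1 x.2.1, x.1.2, x.2.2⟩
        left_inv := by
          intro E
          apply Subtype.ext
          exact Fin.cons_self_tail E.1
        right_inv := by
          rintro ⟨⟨e, he⟩, ⟨E, hE⟩⟩
          rfl }
    rw [Nat.card_congr eqv, Nat.card_sigma, mul_sum]
    have hms : k * (s + 1) = k * s + k := by ring
    have hstep : ∀ e : {e : Fin (k+1) → V // Function.Injective (φ ∘ e)},
        Fintype.card V * Nat.card
          {E : Fin s → Fin (k+1) → V // GoodSeq s (merge φ (φ ∘ e.1)) E} =
        wt (merge φ (φ ∘ e.1)) * (Fintype.card V ^ s * ((k * s).factorial * (k+1) ^ s)) := by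
      intro e
      apply ih
      have := card_image_merge φ (φ ∘ e.1) (fun i => mem_image_of_mem _ (mem_univ _))
      rw [card_image_of_injective _ e.2, hc, card_univ, Fintype.card_fin] at this
      omega
    rw [sum_congr rfl (fun e _ => hstep e), ← sum_mul, sum_wt_merge, hc, Nat.add_sub_cancel]
    have hf := Nat.factorial_mul_descFactorial (n := k * (s+1)) (k := k) (by omega)
    rw [show k * (s+1) - k = k * s by omega] at hf
    rw [← hf]
    ring

theorem transitive_iff {V : Type} [Fintype V] [DecidableEq V] (h2 : 2 ≤ Fintype.card V)
    (p : Perm V) : (∀ x y, SameCycle p x y) ↔ p.cycleType = {Fintype.card V} := by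
  constructor
  · intro h
    have hne : ∀ x, p x ≠ x := by
      intro x hx
      obtain ⟨y, hy⟩ : ∃ y, y ≠ x := by
        have : Nontrivial V := Fintype.one_lt_card_iff_nontrivial.1 h2
        exact exists_ne x
      obtain ⟨i, hi⟩ := h x y
      rw [zpow_apply_eq_self_of_apply_eq_self hx] at hi
      exact hy hi.symm
    obtain ⟨x⟩ : Nonempty V := Fintype.card_pos_iff.1 (by omega)
    have hcyc : p.IsCycle := ⟨x, hne x, fun y _ => h x y⟩
    rw [hcyc.cycleType, ← card_univ]
    congr 2
    ext y
    simp [hne]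
  · intro h x y
    have hcyc : p.IsCycle := by rw [← card_cycleType_eq_one, h]; simp
    have hs : p.support = univ := by
      rw [← card_eq_iff_eq_univ, ← sum_cycleType, h]; simp
    exact hcyc.sameCycle (mem_support.1 (by simp [hs])) (mem_support.1 (by simp [hs]))

/-- Factorizations of `ρ` into cycles given by arbitrary injective tuples. -/
abbrev Fact (V : Type) [DecidableEq V] (n k : ℕ) (ρ : Perm V) : Type :=
  {E : Fin n → Fin (k+1) → V // (∀ j, Function.Injective (E j)) ∧ prd E = ρ}

theorem card_fact_conj {V : Type} [DecidableEq V] {n k : ℕ} (ρ g : Perm V) :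
    Nat.card (Fact V n k (g * ρ * g⁻¹)) = Nat.card (Fact V n k ρ) := by
  symm
  refine Nat.card_congr
    { toFun := fun E => ⟨fun j => g ∘ E.1 j, fun j => g.injective.comp (E.2.1 j), ?_⟩
      invFun := fun E => ⟨fun j => (g⁻¹ : Perm V) ∘ E.1 j, fun j => (g⁻¹ : Perm V).injective.comp (E.2.1 j), ?_⟩
      left_inv := ?_
      right_inv := ?_ }
  · rw [prd_conj _ E.2.1, E.2.2]
  · rw [prd_conj _ E.2.1, E.2.2]; group
  · intro E; ext; simp
  · intro E; ext; simp

theorem card_fact {V : Type} [Fintype V] [DecidableEq V] {n k : ℕ} (hn : 1 ≤ n) (hk : 1 ≤ k)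
    (hV : Fintype.card V = k * n + 1) (σ : Perm V) (hσ : σ.cycleType = {Fintype.card V}) :
    Fintype.card V * Nat.card (Fact V n k σ) = Fintype.card V ^ n * (k+1) ^ n := by
  classical
  have h2 : 2 ≤ Fintype.card V := by
    have := Nat.mul_pos hk hn
    omega
  have hcid : (univ.image (id : V → V)).card = k * n + 1 := by simp [hV]
  have hw : wt (id : V → V) = 1 := by
    unfold wt fib
    simp [filter_eq']
  have hgood := card_good (k := k) (s := n) (id : V → V) hcid
  have hiff : ∀ E : Fin n → Fin (k+1) → V, GoodSeq n id E ↔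
      (∀ j, Function.Injective (E j)) ∧ (prd E).cycleType = {Fintype.card V} := by
    intro E
    rw [← transitive_iff h2]
    constructor
    · intro h
      have := good_transitive (p := 1) (φ := id) (fun x y => by simp) E h hcid
      simpa using this
    · rintro ⟨h3, h4⟩
      exact (transitive_good (p := 1) (φ := id) (fun x => rfl) E h3 (by simpa using h4)).2 hcid
  let eqv : {E : Fin n → Fin (k+1) → V // GoodSeq n id E} ≃
      Σ ρ : {ρ : Perm V // ρ.cycleType = {Fintype.card V}}, Fact V n k ρ.1 :=
    { toFun := fun E => ⟨⟨prd E.1, ((hiff _).1 E.2).2⟩, ⟨E.1, ((hiff _).1 E.2).1, rfl⟩⟩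
      invFun := fun x => ⟨x.2.1, (hiff _).2 ⟨x.2.2.1, by rw [x.2.2.2]; exact x.1.2⟩⟩
      left_inv := by intro E; rfl
      right_inv := by 
        rintro ⟨⟨ρ, hρ⟩, ⟨E, hE, h⟩⟩
        have h' : prd E = ρ := h
        subst h'
        rfl }
  have hconst : ∀ ρ : {ρ : Perm V // ρ.cycleType = {Fintype.card V}},
      Nat.card (Fact V n k ρ.1) = Nat.card (Fact V n k σ) := by
    intro ρ
    have : IsConj σ ρ.1 := isConj_iff_cycleType_eq.2 (hσ.trans ρ.2.symm)
    obtain ⟨g, hg⟩ := isConj_iff.1 this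
    rw [← hg, card_fact_conj]
  have hcyc : Fintype.card {ρ : Perm V // ρ.cycleType = {Fintype.card V}} =
      (k * n).factorial := by
    rw [Fintype.card_subtype, card_of_cycleType_singleton h2 le_rfl, hV]
    simp
  rw [Nat.card_congr eqv, Nat.card_sigma, sum_congr rfl (fun ρ _ => hconst ρ), sum_const,
    card_univ, hcyc, hw, one_mul, smul_eq_mul] at hgood
  apply Nat.eq_of_mul_eq_mul_left (Nat.factorial_pos (k * n))
  linarith

theorem card_fact_min {n k : ℕ} :
    Nat.card (Fact (Fin (k*n+1)) n k (finRotate (k*n+1))) =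
      Nat.card (MinKFact n k) * (k+1) ^ n := by
  have hprd : ∀ (a : Fin n → Fin (k+1) → Fin (k*n+1)) (_ : ∀ j, Function.Injective (a j))
      (r : Fin n → Fin (k+1)), prd (fun j i => a j (i + r j)) = prd a := by
    intro a ha r
    unfold prd
    congr 3
    funext j
    exact cyc_rot (ha j) (r j)
  let f : MinKFact n k × (Fin n → Fin (k+1)) →
      Fact (Fin (k*n+1)) n k (finRotate (k*n+1)) := fun x =>
    ⟨fun j i => x.1.a j (i + x.2 j), fun j => (x.1.inj j).comp (add_left_injective _),
      (hprd _ x.1.inj _).trans x.1.prod_eq⟩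
  have hf : Function.Bijective f := by
    constructor
    · rintro ⟨⟨a, h1, h2, h3⟩, r⟩ ⟨⟨a', h1', h2', h3'⟩, r'⟩ h
      have h4 : ∀ j i, a j (i + r j) = a' j (i + r' j) := fun j i =>
        congrFun (congrFun (congrArg Subtype.val h) j) i
      have hr : r = r' := by
        funext j
        have e1 := h4 j (- r j)
        have e2 := h4 j (- r' j)
        rw [neg_add_cancel] at e1 e2
        have e3 : a j 0 = a' j 0 := by
          apply le_antisymm
          · rw [← e2]; exact h2 _ _
          · rw [e1]; exact h2' _ _
        rw [e3] at e1
        have := h1' j e1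
        exact (neg_add_eq_zero.1 this.symm)
      subst hr
      have ha : a = a' := by
        funext j i
        have := h4 j (i - r j)
        simpa using this
      subst ha
      rfl
    · rintro ⟨E, hE, hp⟩
      choose m hm using fun j => Finite.exists_min (E j)
      refine ⟨⟨⟨fun j i => E j (i + m j), fun j => (hE j).comp (add_left_injective _), ?_, ?_⟩,
        fun j => - m j⟩, ?_⟩
      · intro j i
        simpa using hm j _
      · exact (hprd E hE m).trans hp
      · apply Subtype.ext
        funext j i
        simp [f]
  rw [← Nat.card_congr (Equiv.ofBijective f hf), Nat.card_prod]
  simp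

end KFactAux

/-- For all `n, k ≥ 1`, the number of minimal `k`-factorizations of the
long cycle `σ_{kn}` is `|F_n^k| = (kn+1)^{n-1}`. -/
theorem stmt13 (n k : ℕ) (hn : 1 ≤ n) (hk : 1 ≤ k) :
    Nat.card (MinKFact n k) = (k * n + 1) ^ (n - 1) := by
  have h2 : 2 ≤ k * n + 1 := by
    have := Nat.mul_pos hk hn
    omega
  have h := KFactAux.card_fact (V := Fin (k*n+1)) hn hk (by simp) (finRotate (k*n+1))
    (by rw [Fintype.card_fin]; exact cycleType_finRotate_of_le h2)
  rw [KFactAux.card_fact_min, Fintype.card_fin, ← mul_assoc] at h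
  have h3 := Nat.eq_of_mul_eq_mul_right (Nat.pow_pos (Nat.succ_pos k)) h
  obtain ⟨m, rfl⟩ : ∃ m, n = m + 1 := ⟨n - 1, by omega⟩
  rw [pow_succ'] at h3
  exact Nat.eq_of_mul_eq_mul_left (by omega) h3
end

section
/- For all n, k ≥ 1, the number of k-forests on vertex set {1,…,n} is |R_n^k| = (kn+1)^{n−1}. -/
namespace KFCount

/-- `E f a b`: the vertex `b` is the parent of `a`. -/
def E {V A K : Type} (f : V → A ⊕ (V × K)) (a b : V) : Prop := ∃ c, f a = Sum.inr (b, c)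

def Acyc {V A K : Type} (f : V → A ⊕ (V × K)) : Prop := ∀ v, ¬ Relation.TransGen (E f) v v

/-- Number of acyclic functions. -/
noncomputable def N (V A K : Type) : ℕ := Nat.card {f : V → A ⊕ (V × K) // Acyc f}

theorem exists_inl {V A K : Type} [Finite V] [Nonempty V] (f : V → A ⊕ (V × K)) (hf : Acyc f) :
    ∃ v a, f v = Sum.inl a := by
  have : Std.Irrefl (fun a b => Relation.TransGen (E f) b a) := ⟨fun a => hf a⟩
  have : IsTrans V (fun a b => Relation.TransGen (E f) b a) := ⟨fun a b c h1 h2 => h2.trans h1⟩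
  have wf : WellFounded (fun a b => Relation.TransGen (E f) b a) :=
    Finite.wellFounded_of_trans_of_irrefl _
  obtain ⟨m, -, hm⟩ := wf.has_min Set.univ Set.univ_nonempty
  rcases h : f m with a | ⟨u, c⟩
  · exact ⟨m, a, h⟩
  · exact absurd (Relation.TransGen.single ⟨c, h⟩) (hm u trivial)

/-- Splitting the vertex set. -/
noncomputable def e {V : Type} (K : Type) (S : Finset V) :
    (({v // v ∈ S} × K) ⊕ ({v // v ∉ S} × K)) ≃ V × K := by
  classical
  exact (Equiv.sumProdDistrib _ _ _).symm.trans
    (Equiv.prodCongr (Equiv.sumCompl (fun v => v ∈ S)) (Equiv.refl K))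

theorem e_inr {V K : Type} (S : Finset V) (u : {v // v ∉ S}) (c : K) :
    e K S (Sum.inr (u, c)) = (u.1, c) := by
  simp [e]

open Classical in
noncomputable def glue {V A K : Type} (S : Finset V) (p : {v // v ∈ S} → A)
    (g : {v // v ∉ S} → ({v // v ∈ S} × K) ⊕ ({v // v ∉ S} × K)) : V → A ⊕ (V × K) :=
  fun v => if h : v ∈ S then Sum.inl (p ⟨v, h⟩) else Sum.inr (e K S (g ⟨v, h⟩))

theorem glue_E {V A K : Type} (S : Finset V) (p : {v // v ∈ S} → A)
    (g : {v // v ∉ S} → ({v // v ∈ S} × K) ⊕ ({v // v ∉ S} × K)) (a b : {v // v ∉ S}) :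
    E (glue S p g) a.1 b.1 ↔ E g a b := by
  unfold E
  refine exists_congr fun c => ?_
  simp only [glue, a.2, dite_false, Sum.inr.injEq]
  rw [← e_inr S b c, (e K S).injective.eq_iff]

theorem glue_acyc {V A K : Type} (S : Finset V) (p : {v // v ∈ S} → A)
    (g : {v // v ∉ S} → ({v // v ∈ S} × K) ⊕ ({v // v ∉ S} × K)) :
    Acyc (glue S p g) ↔ Acyc g := by
  have out : ∀ a b, E (glue S p g) a b → a ∉ S := by
    rintro a b ⟨c, h⟩ ha
    simp [glue, ha] at h
  constructor
  · intro h v hv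
    exact h v.1 (hv.lift Subtype.val fun a b hab => (glue_E S p g a b).2 hab)
  · intro h v hv
    have key : ∀ a b, Relation.TransGen (E (glue S p g)) a b → ∀ hb : b ∉ S,
        ∃ ha : a ∉ S, Relation.TransGen (E g) ⟨a, ha⟩ ⟨b, hb⟩ := by
      intro a b hab
      induction hab with
      | single hab =>
        intro hb
        exact ⟨out _ _ hab, .single ((glue_E S p g ⟨_, out _ _ hab⟩ ⟨_, hb⟩).1 hab)⟩
      | tail _ hbc ih =>
        intro hc
        obtain ⟨ha, t⟩ := ih (out _ _ hbc)
        exact ⟨ha, t.tail ((glue_E S p g ⟨_, out _ _ hbc⟩ ⟨_, hc⟩).1 hbc)⟩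
    have hvS : v ∉ S := by
      obtain ⟨w, hw, -⟩ := (Relation.TransGen.head'_iff).1 hv
      exact out _ _ hw
    obtain ⟨_, t⟩ := key v v hv hvS
    exact h _ t

noncomputable def glueSigma {V A K : Type}
    (x : Σ S : Finset V, ({v // v ∈ S} → A) ×
      {g : {v // v ∉ S} → ({v // v ∈ S} × K) ⊕ ({v // v ∉ S} × K) // Acyc g}) :
    {f : V → A ⊕ (V × K) // Acyc f} :=
  ⟨glue x.1 x.2.1 x.2.2.1, (glue_acyc _ _ _).2 x.2.2.2⟩

theorem mem_iff {V A K : Type} (S : Finset V) (p : {v // v ∈ S} → A)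
    (g : {v // v ∉ S} → ({v // v ∈ S} × K) ⊕ ({v // v ∉ S} × K)) (v : V) :
    v ∈ S ↔ (glue S p g v).isLeft = true := by
  by_cases h : v ∈ S <;> simp [glue, h]

theorem glueSigma_bij {V A K : Type} [Fintype V] :
    Function.Bijective (glueSigma (V := V) (A := A) (K := K)) := by
  classical
  constructor
  · rintro ⟨S, p, g, hg⟩ ⟨S', p', g', hg'⟩ h
    have h1 : glue S p g = glue S' p' g' := congrArg Subtype.val h
    have hS : S = S' := by
      ext v
      rw [mem_iff S p g, mem_iff S' p' g', h1]
    subst hS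
    have hp : p = p' := by
      funext v
      have := congrFun h1 v.1
      simpa [glue, v.2] using this
    have hgg : g = g' := by
      funext v
      have := congrFun h1 v.1
      simpa [glue, v.2] using this
    subst hp hgg
    rfl
  · rintro ⟨f, hf⟩
    let S : Finset V := Finset.univ.filter fun v => (f v).isLeft = true
    have hS : ∀ v, v ∈ S ↔ (f v).isLeft = true := by simp [S]
    have hp : ∀ v : {v // v ∈ S}, ∃ a, f v.1 = Sum.inl a := fun v =>
      Sum.isLeft_iff.1 ((hS v.1).1 v.2)
    have hg : ∀ v : {v // v ∉ S}, ∃ y, f v.1 = Sum.inr (e K S y) := by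
      intro v
      have := mt (hS v.1).2 v.2
      rcases h : f v.1 with a | y
      · simp [h] at this
      · exact ⟨(e K S).symm y, by simp⟩
    choose p hp using hp
    choose g hg using hg
    have hfg : glue S p g = f := by
      funext v
      by_cases h : v ∈ S
      · simp [glue, h, hp ⟨v, h⟩]
      · simp [glue, h, hg ⟨v, h⟩]
    refine ⟨⟨S, p, g, (glue_acyc S p g).1 (hfg ▸ hf)⟩, ?_⟩
    exact Subtype.ext hfg

theorem N_rec (V A K : Type) [Fintype V] [Finite A] [Finite K] :
    N V A K = ∑ S : Finset V,
      Nat.card A ^ S.card * N {v // v ∉ S} ({v // v ∈ S} × K) K := by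
  classical
  unfold N
  rw [← Nat.card_congr (Equiv.ofBijective _ (glueSigma_bij (V := V) (A := A) (K := K))),
    Nat.card_sigma]
  refine Finset.sum_congr rfl fun S _ => ?_
  rw [Nat.card_prod, Nat.card_fun]
  simp

theorem N_zero (V A K : Type) [IsEmpty V] : N V A K = 1 := by
  unfold N
  have : Unique {f : V → A ⊕ (V × K) // Acyc f} :=
    { default := ⟨fun v => isEmptyElim v, fun v => isEmptyElim v⟩
      uniq := fun f => Subtype.ext (funext fun v => isEmptyElim v) }
  exact Nat.card_unique

theorem N_empty (V A K : Type) [Finite V] [Nonempty V] [IsEmpty A] : N V A K = 0 := by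
  unfold N
  have : IsEmpty {f : V → A ⊕ (V × K) // Acyc f} :=
    ⟨fun f => by obtain ⟨v, a, -⟩ := exists_inl f.1 f.2; exact isEmptyElim a⟩
  exact Nat.card_of_isEmpty

theorem N_eq (K : Type) [Finite K] : ∀ (m : ℕ) (V A : Type) [Fintype V] [Finite A],
    Fintype.card V = m + 1 →
    N V A K = Nat.card A * (Nat.card A + Nat.card K * (m + 1)) ^ m := by
  classical
  intro m
  induction m using Nat.strong_induction_on with
  | _ m ih =>
  intro V A _ _ hV
  set x := Nat.card A
  set k := Nat.card K
  have hne : Nonempty V := Fintype.card_pos_iff.1 (by omega)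
  let F : ℕ → ℕ := fun j => x ^ j *
    (if j = m + 1 then 1 else j * k * (k * (m + 1)) ^ (m - j))
  have hterm : ∀ S : Finset V,
      x ^ S.card * N {v // v ∉ S} ({v // v ∈ S} × K) K = F S.card := by
    intro S
    have hc : Fintype.card {v // v ∉ S} = m + 1 - S.card := by
      rw [Fintype.card_subtype_compl, hV, Fintype.card_coe]
    have hle : S.card ≤ m + 1 := hV ▸ Finset.card_le_univ S
    simp only [F]
    congr 1
    split_ifs with h
    · have : IsEmpty {v // v ∉ S} := Fintype.card_eq_zero_iff.1 (by omega)
      exact N_zero _ _ _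
    · by_cases h0 : S.card = 0
      · have hS : S = ∅ := Finset.card_eq_zero.1 h0
        have h1 : Nonempty {v // v ∉ S} := Fintype.card_pos_iff.1 (by omega)
        have h2 : IsEmpty ({v // v ∈ S} × K) := ⟨fun y => by simpa [hS] using y.1.2⟩
        rw [N_empty, h0]; simp
      · rw [ih (m - S.card) (by omega) _ _ (by omega), Nat.card_prod]
        have : Nat.card {v // v ∈ S} = S.card := by simp
        rw [this]
        congr 2
        obtain ⟨d, hd⟩ : ∃ d, m = S.card + d := ⟨m - S.card, by omega⟩
        rw [hd, Nat.add_sub_cancel_left]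
        ring
  rw [N_rec, Finset.sum_congr rfl fun S _ => hterm S, ← Finset.powerset_univ,
    Finset.sum_powerset_apply_card F, Finset.card_univ, hV, Finset.sum_range_succ']
  have h0 : F 0 = 0 := by simp [F]
  rw [h0, add_pow, Finset.mul_sum]
  simp only [smul_eq_mul, mul_zero, add_zero]
  refine Finset.sum_congr rfl fun j hj => ?_
  have hj' : j ≤ m := by simpa [Nat.lt_succ_iff] using hj
  by_cases h : j = m
  · subst h; simp [F]; ring
  · obtain ⟨d, hd⟩ : ∃ d, m = j + 1 + d := ⟨m - (j+1), by omega⟩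
    have hch := Nat.add_one_mul_choose_eq m j
    have e1 : m - (j + 1) = d := by omega
    have e2 : m - j = d + 1 := by omega
    simp only [F, Nat.add_right_cancel_iff, h, if_false, e1, e2]
    calc _ = ((m+1).choose (j+1) * (j+1)) * (x ^ (j+1) * k * (k * (m+1))^d) := by ring
      _ = _ := by rw [← hch, Nat.cast_id]; ring

def toFun {n k : ℕ} (F : KForest n k) (v : Fin n) : Unit ⊕ (Fin n × Fin k) :=
  match F.parent v with
  | none => Sum.inl ()
  | some u => Sum.inr (u, ⟨F.colour v, F.colour_lt v⟩)

theorem toFun_E {n k : ℕ} (F : KForest n k) :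
    E (toFun F) = fun a b => F.parent a = some b := by
  funext a b
  unfold E toFun
  cases h : F.parent a <;> simp

def conv {n k : ℕ} (F : KForest n k) :
    {f : Fin n → Unit ⊕ (Fin n × Fin k) // Acyc f} :=
  ⟨toFun F, by unfold Acyc; rw [toFun_E]; exact F.acyclic⟩

theorem conv_bij {n k : ℕ} (hk : 1 ≤ k) : Function.Bijective (conv (n := n) (k := k)) := by
  constructor
  · intro F G h
    have h1 : ∀ v, toFun F v = toFun G v := fun v => congrFun (congrArg Subtype.val h) v
    have hp : F.parent = G.parent := by
      funext v
      have := h1 v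
      unfold toFun at this
      cases hF : F.parent v <;> cases hG : G.parent v <;> simp_all
    have hc : F.colour = G.colour := by
      funext v
      have := h1 v
      unfold toFun at this
      cases hF : F.parent v <;> cases hG : G.parent v
      · rw [F.colour_root v hF, G.colour_root v hG]
      all_goals simp_all
    obtain ⟨⟨p, a⟩, c, _, _⟩ := F
    obtain ⟨⟨p', a'⟩, c', _, _⟩ := G
    simp only at hp hc
    subst hp hc
    rfl
  · rintro ⟨f, hf⟩
    let p : Fin n → Option (Fin n) := fun v => Sum.elim (fun _ => none) (fun y => some y.1) (f v)
    have hE : (fun a b => p a = some b) = E f := by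
      funext a b
      simp only [E, p]
      rcases h : f a with _ | ⟨u, c⟩ <;> simp
    refine ⟨{ parent := p
              acyclic := by rw [hE]; exact hf
              colour := fun v => Sum.elim (fun _ => 0) (fun y => y.2.1) (f v)
              colour_lt := ?_
              colour_root := ?_ }, ?_⟩
    · intro v
      rcases h : f v with _ | ⟨u, c⟩
      · simp; omega
      · simp
    · intro v
      simp only [p]
      rcases h : f v with _ | ⟨u, c⟩ <;> simp
    · refine Subtype.ext (funext fun v => ?_)
      simp only [conv, toFun, p]
      have hcases : (∃ a, f v = Sum.inl a) ∨ (∃ y, f v = Sum.inr y) := by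
        rcases f v with a | y
        · exact Or.inl ⟨a, rfl⟩
        · exact Or.inr ⟨y, rfl⟩
      rcases hcases with ⟨a, h⟩ | ⟨y, h⟩ <;> simp [h]

end KFCount

/-- For all `n, k ≥ 1`, the number of `k`-forests on vertex set
`{1,…,n}` is `|R_n^k| = (kn+1)^{n-1}`. -/
theorem stmt14 (n k : ℕ) (hn : 1 ≤ n) (hk : 1 ≤ k) :
    Nat.card (KForest n k) = (k * n + 1) ^ (n - 1) := by
  obtain ⟨m, rfl⟩ : ∃ m, n = m + 1 := ⟨n - 1, by omega⟩
  rw [Nat.card_congr (Equiv.ofBijective _ (KFCount.conv_bij hk))]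
  have := KFCount.N_eq (Fin k) m (Fin (m + 1)) Unit (by simp)
  unfold KFCount.N at this
  rw [this]
  simp [add_comm]
end

section
/- For all n, k ≥ 1, the number of k-parking functions of length n is |P_n^k| = (kn+1)^{n−1}. -/
/-- Counting characterization of parking functions. -/
theorem pf_iff (k n : ℕ) (hk : 1 ≤ k) (p : Fin n → ℕ) :
    IsParkingFunction k p ↔
      ∀ m ≤ k * n, m ≤ k * (Finset.univ.filter (fun i => p i < m)).card := by
  have key : ∀ (i : Fin n) (a : ℕ), p (Tuple.sort p i) ≤ a ↔
      (i : ℕ) < (Finset.univ.filter (fun j => p j ≤ a)).card := by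
    intro i a
    have h := Tuple.lt_card_le_iff_apply_le_of_monotone (f := p ∘ Tuple.sort p) (j := i) (a := a)
      (Tuple.monotone_sort p)
    have e : (Finset.univ.filter (fun j => p j ≤ a)).card =
        (Finset.univ.filter (fun j => (p ∘ Tuple.sort p) j ≤ a)).card := by
      symm
      apply Finset.card_bij (fun j _ => Tuple.sort p j)
      · intro j hj; simpa using hj
      · intro a _ b _ h; simpa using h
      · intro b hb
        exact ⟨(Tuple.sort p).symm b, by simpa using hb, by simp⟩
    rw [e]
    exact h.symm
  unfold IsParkingFunction
  constructor
  · intro h m hm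
    rcases Nat.eq_zero_or_pos m with rfl | hm0
    · simp
    have hj : (m - 1) / k < n := by
      rw [Nat.div_lt_iff_lt_mul (by omega)]
      rw [mul_comm]; omega
    have h1 := (key ⟨(m-1)/k, hj⟩ _).1 (h ⟨(m-1)/k, hj⟩)
    have h2 : (Finset.univ.filter (fun j => p j ≤ k * ((m-1)/k))).card ≤
        (Finset.univ.filter (fun i => p i < m)).card := by
      apply Finset.card_le_card
      intro j
      simp only [Finset.mem_filter, Finset.mem_univ, true_and]
      intro hh
      have := Nat.mul_div_le (m-1) k
      omega
    have h3 : (m-1)/k + 1 ≤ (Finset.univ.filter (fun i => p i < m)).card := by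
      simp only at h1; omega
    have h4 := Nat.mul_le_mul_left k h3
    have h5 := Nat.lt_mul_div_succ (m-1) (show 0 < k by omega)
    omega
  · intro h i
    rw [key]
    have h1 := h (k * i + 1) (by
      have := Nat.mul_le_mul_left k (show (i:ℕ) + 1 ≤ n from i.2)
      rw [mul_add] at this; omega)
    simp only [Nat.lt_succ_iff] at h1
    exact lt_of_mul_lt_mul_left (show k * i < _ by omega) (Nat.zero_le k)

/-- Number of indices whose value lies in the cyclic window of length `m` starting at `c`. -/
def winCard (N n : ℕ) (q : Fin n → ZMod N) (c : ZMod N) (m : ℕ) : ℕ :=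
  (Finset.univ.filter (fun i => (q i - c).val < m)).card

/-- Partial sums of the periodic walk attached to `q`. -/
def walk (N n k : ℕ) (q : Fin n → ZMod N) (m : ℕ) : ℤ :=
  ∑ v ∈ Finset.range m,
    ((k : ℤ) * (Finset.univ.filter (fun i => q i = (v : ZMod N))).card - 1)

theorem walk_add (N n k : ℕ) [NeZero N] (q : Fin n → ZMod N) (c m : ℕ) (hm : m ≤ N) :
    walk N n k q (c + m) = walk N n k q c + k * winCard N n q c m - m := by
  induction m with
  | zero => simp [winCard]
  | succ m ih =>
    have ih := ih (by omega)
    have e : winCard N n q c (m+1) = winCard N n q c m +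
        (Finset.univ.filter (fun i => q i = ((c + m : ℕ) : ZMod N))).card := by
      unfold winCard
      rw [← Finset.card_union_of_disjoint]
      · congr 1
        ext i
        simp only [Finset.mem_filter, Finset.mem_univ, true_and, Finset.mem_union,
          Nat.lt_succ_iff, le_iff_lt_or_eq]
        have : (q i - c).val = m ↔ q i = ((c + m : ℕ) : ZMod N) := by
          push_cast
          rw [← sub_eq_iff_eq_add']
          constructor
          · intro h; rw [← h]; simp
          · intro h; rw [h, ZMod.val_natCast_of_lt (by omega)]
        rw [this]
      · rw [Finset.disjoint_filter]
        intro i _ h1 h2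
        rw [h2] at h1
        push_cast at h1
        rw [add_sub_cancel_left, ZMod.val_natCast_of_lt (by omega)] at h1
        omega
    have e2 : walk N n k q (c + (m+1)) = walk N n k q (c + m) +
      ((k : ℤ) * (Finset.univ.filter (fun i => q i = ((c + m : ℕ) : ZMod N))).card - 1) := by
      unfold walk
      rw [← add_assoc, Finset.sum_range_succ]
    rw [e2, ih, e]
    push_cast
    ring

/-- The shift of `q` by `c` satisfies the parking condition. -/
def Good (N n k : ℕ) (q : Fin n → ZMod N) (c : ZMod N) : Prop :=
  ∀ m < N, m ≤ k * winCard N n q c m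

theorem good_iff (N n k : ℕ) [NeZero N] (q : Fin n → ZMod N) (c : ℕ) :
    Good N n k q c ↔ ∀ m < N, walk N n k q c ≤ walk N n k q (c + m) := by
  unfold Good
  refine forall₂_congr fun m hm => ?_
  rw [walk_add N n k q c m hm.le]
  zify
  constructor <;> intro h <;> linarith

theorem walk_period (N n k : ℕ) [NeZero N] (hN : N = k * n + 1) (q : Fin n → ZMod N) (c : ℕ) :
    walk N n k q (c + N) = walk N n k q c - 1 := by
  rw [walk_add N n k q c N le_rfl]
  have : winCard N n q c N = n := by
    unfold winCard
    rw [Finset.filter_true_of_mem (fun i _ => ZMod.val_lt _)]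
    simp
  rw [this]
  have : (N : ℤ) = k * n + 1 := by exact_mod_cast hN
  linarith

theorem exists_unique_good (N n k : ℕ) [NeZero N] (hN : N = k * n + 1) (q : Fin n → ZMod N) :
    ∃! c : ZMod N, Good N n k q c := by
  have hN0 : 0 < N := by omega
  obtain ⟨b, hbm, hb⟩ := Finset.exists_min_image (Finset.range N) (walk N n k q) ⟨0, by simpa⟩
  have hex : ∃ c, c < N ∧ ∀ x < N, walk N n k q c ≤ walk N n k q x :=
    ⟨b, by simpa using hbm, fun x hx => hb x (by simpa using hx)⟩
  classical
  obtain ⟨hc, hmin⟩ := Nat.find_spec hex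
  have hfirst := fun m => Nat.find_min (m := m) hex
  set c := Nat.find hex with hcdef
  clear_value c
  refine ⟨(c : ZMod N), ?_, ?_⟩
  · change Good N n k q c
    rw [good_iff]
    intro m hm
    by_cases h : c + m < N
    · exact hmin _ h
    · obtain ⟨d, hd⟩ : ∃ d, c + m = d + N := ⟨c + m - N, by omega⟩
      rw [hd, walk_period N n k hN]
      have h1 := hfirst d (by omega)
      push Not at h1
      obtain ⟨x, hx, hlt⟩ := h1 (by omega)
      have := hmin x hx
      omega
  · have uniq : ∀ a b : ℕ, a < b → b < N → Good N n k q a → Good N n k q b → False := by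
      intro a b hab hbN ha hb
      rw [good_iff] at ha hb
      have h1 := ha (b - a) (by omega)
      have h2 := hb (a + N - b) (by omega)
      rw [show a + (b - a) = b by omega] at h1
      rw [show b + (a + N - b) = a + N by omega, walk_period N n k hN] at h2
      omega
    have hg : Good N n k q c := by
      rw [good_iff]
      intro m hm
      by_cases h : c + m < N
      · exact hmin _ h
      · obtain ⟨d, hd⟩ : ∃ d, c + m = d + N := ⟨c + m - N, by omega⟩
        rw [hd, walk_period N n k hN]
        have h1 := hfirst d (by omega)
        push Not at h1
        obtain ⟨x, hx, hlt⟩ := h1 (by omega)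
        have := hmin x hx
        omega
    intro y hy
    have hyv : ((y.val : ℕ) : ZMod N) = y := by simp
    have hy' : Good N n k q (y.val : ℕ) := by rw [hyv]; exact hy
    rcases lt_trichotomy y.val c with h | h | h
    · exact (uniq _ _ h hc hy' hg).elim
    · rw [← h, hyv]
    · exact (uniq _ _ h (ZMod.val_lt y) hg hy').elim

theorem good_shift (N n k : ℕ) (q : Fin n → ZMod N) (c : ZMod N) :
    Good N n k (fun i => q i + c) c ↔ Good N n k q 0 := by
  simp [Good, winCard]

theorem card_good (N n k : ℕ) [NeZero N] (hN : N = k * n + 1) :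
    Nat.card {q : Fin n → ZMod N // Good N n k q 0} * N = N ^ n := by
  have hb : Function.Bijective
      (fun x : {q : Fin n → ZMod N // Good N n k q 0} × ZMod N =>
        (fun i => x.1.1 i + x.2 : Fin n → ZMod N)) := by
    constructor
    · rintro ⟨⟨q, hq⟩, c⟩ ⟨⟨q', hq'⟩, c'⟩ h
      simp only at h
      have h1 := (good_shift N n k q c).2 hq
      have h2 := (good_shift N n k q' c').2 hq'
      rw [h] at h1
      have := (exists_unique_good N n k hN _).unique h1 h2
      subst this
      have : q = q' := by
        ext i
        exact add_right_cancel (congrFun h i)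
      subst this
      rfl
    · intro r
      obtain ⟨c, hc, -⟩ := exists_unique_good N n k hN r
      refine ⟨⟨⟨fun i => r i - c, ?_⟩, c⟩, ?_⟩
      · rw [← good_shift N n k _ c]
        simpa using hc
      · simp
  have := Nat.card_eq_of_bijective _ hb
  rw [Nat.card_prod] at this
  simpa [Nat.card_fun] using this

theorem card_pf (N n k : ℕ) [NeZero N] (hk : 1 ≤ k) (hN : N = k * n + 1) :
    Nat.card {p : Fin n → ℕ // IsParkingFunction k p} =
      Nat.card {q : Fin n → ZMod N // Good N n k q 0} := by
  have hgood : ∀ q : Fin n → ZMod N,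
      Good N n k q 0 ↔ IsParkingFunction k (fun i => (q i).val) := by
    intro q
    rw [pf_iff k n hk]
    simp only [Good, winCard, sub_zero, hN, Nat.lt_succ_iff]
  have hlt : ∀ p : Fin n → ℕ, IsParkingFunction k p → ∀ i, p i < N := by
    intro p hp i
    have h1 := hp ((Tuple.sort p).symm i)
    rw [Equiv.apply_symm_apply] at h1
    have := Nat.mul_le_mul_left k ((Tuple.sort p).symm i).2.le
    omega
  have hv : ∀ p : Fin n → ℕ, IsParkingFunction k p →
      (fun i => ((p i : ℕ) : ZMod N).val) = p := by
    intro p hp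
    ext i
    exact ZMod.val_natCast_of_lt (hlt p hp i)
  refine Nat.card_congr ⟨fun p => ⟨fun i => (p.1 i : ZMod N), ?_⟩,
    fun q => ⟨fun i => (q.1 i).val, (hgood _).1 q.2⟩, ?_, ?_⟩
  · rw [hgood, hv p.1 p.2]; exact p.2
  · intro p; exact Subtype.ext (hv p.1 p.2)
  · intro q; apply Subtype.ext; ext i; simp

/-- For all `n, k ≥ 1`, the number of `k`-parking functions of length
`n` is `|P_n^k| = (kn+1)^{n-1}`. -/
theorem stmt15 (n k : ℕ) (hn : 1 ≤ n) (hk : 1 ≤ k) :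
    Nat.card {p : Fin n → ℕ // IsParkingFunction k p} = (k * n + 1) ^ (n - 1) := by
  have h := card_good (k * n + 1) n k rfl
  rw [← card_pf (k * n + 1) n k hk rfl] at h
  obtain ⟨m, rfl⟩ : ∃ m, n = m + 1 := ⟨n - 1, by omega⟩
  rw [pow_succ (k * (m + 1) + 1) m] at h
  exact Nat.eq_of_mul_eq_mul_right (by omega) h
end
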